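/- (Poincaré–Birkhoff) Let f be a homeomorphism of the closed annulus A = (ℝ/ℤ) × [0,1] that is isotopic to the identity and preserves a finite area, and let F be a lift of f to ℝ × [0,1] commuting with T(x,y) = (x+1,y) that rotates the two boundary lines in opposite directions: p₁(F(x,0)) < x and p₁(F(x,1)) > x for all x ∈ ℝ. Then there exist two distinct points z₁ ≠ z₂ in the interior (ℝ/ℤ) × (0,1) with f(z₁) = z₁ and f(z₂) = z₂, each admitting a lift fixed by F. -/

import Mathlib

open MeasureTheory Filter Topology

/-- The circle `ℝ/ℤ`. -/
abbrev Circle1 : Type := AddCircle (1 : ℝ)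

/-- The closed annulus `(ℝ/ℤ) × [0,1]`. -/
abbrev AnnC : Type := Circle1 × ↥(Set.Icc (0 : ℝ) 1)

/-- The universal covering space `ℝ × [0,1]` of the closed annulus. -/
abbrev StripC : Type := ℝ × ↥(Set.Icc (0 : ℝ) 1)

/-- The covering map `π(x, y) = (x mod 1, y)`. -/
noncomputable def projC : StripC → AnnC := fun p => ((p.1 : Circle1), p.2)

/-- The deck transformation `T(x, y) = (x + 1, y)`. -/
def deckC : StripC → StripC := fun p => (p.1 + 1, p.2)

/-- `f` is isotopic to the identity. -/
def IsotopicToIdC (f : AnnC → AnnC) : Prop :=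
  ∃ H : ↥(Set.Icc (0 : ℝ) 1) × AnnC → AnnC, Continuous H ∧
    (∀ z, H (⟨0, by norm_num⟩, z) = z) ∧
    (∀ z, H (⟨1, by norm_num⟩, z) = f z) ∧
    (∀ t, ∃ g : AnnC ≃ₜ AnnC, ∀ z, H (t, z) = g z)

/-- `f` preserves a finite area: a finite Borel measure, without atoms,
positive on nonempty open sets. -/
def PreservesFiniteAreaC (f : AnnC → AnnC) : Prop :=
  ∃ μ : Measure AnnC, μ Set.univ < ⊤ ∧ (∀ z, μ {z} = 0) ∧
    (∀ U : Set AnnC, IsOpen U → U.Nonempty → 0 < μ U) ∧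
    MeasurePreserving f μ μ

namespace PB

/-- continuous logarithms exist on star convex sets -/
theorem exists_log {V : Type*} [NormedAddCommGroup V] [NormedSpace ℝ V] {s : Set V} {c : V}
    (hc : c ∈ s) (hs : StarConvex ℝ c s) {φ : V → ℂ} (hφ : ContinuousOn φ s)
    (h0 : ∀ z ∈ s, φ z ≠ 0) :
    ∃ L : V → ℂ, ContinuousOn L s ∧ ∀ z ∈ s, Complex.exp (L z) = φ z := by
  classical
  have key : ∀ (t : unitInterval) (z : s), c + (t : ℝ) • ((z : V) - c) ∈ s := by
    intro t z
    have := hs z.2 (a := 1 - (t : ℝ)) (b := t) (by linarith [t.2.2]) t.2.1 (by ring)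
    convert this using 1
    rw [smul_sub, sub_smul, one_smul]; abel
  let H : C(unitInterval × s, {z : ℂ // z ≠ 0}) :=
    { toFun := fun p => ⟨φ (c + (p.1 : ℝ) • ((p.2 : V) - c)), h0 _ (key p.1 p.2)⟩
      continuous_toFun := by
        refine Continuous.subtype_mk ?_ _
        refine hφ.comp_continuous ?_ (fun p => key p.1 p.2)
        fun_prop }
  let f0 : C(s, ℂ) := ContinuousMap.const _ (Complex.log (φ c))
  have H0 : ∀ a, H (0, a) = (fun z : ℂ ↦ (⟨_, z.exp_ne_zero⟩ : {z : ℂ // z ≠ 0})) (f0 a) := by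
    intro a
    apply Subtype.ext
    simp [H, f0, Complex.exp_log (h0 c hc)]
  let K := Complex.isCoveringMap_exp.liftHomotopy H f0 H0
  have hK : ∀ p, Complex.exp (K p) = φ (c + (p.1 : ℝ) • ((p.2 : V) - c)) := by
    intro p
    have := congrFun (Complex.isCoveringMap_exp.liftHomotopy_lifts H f0 H0) p
    exact congrArg Subtype.val this
  refine ⟨fun z => if hz : z ∈ s then K (1, ⟨z, hz⟩) else 0, ?_, ?_⟩
  · rw [continuousOn_iff_continuous_domRestrict]
    have : s.domRestrict (fun z => if hz : z ∈ s then K (1, ⟨z, hz⟩) else 0) = fun z : s => K (1, z) := by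
      funext z
      simp [Set.domRestrict]
    rw [this]
    fun_prop
  · intro z hz
    simp only [hz, dif_pos, hK]
    simp

theorem exists_log_convex {V : Type*} [NormedAddCommGroup V] [NormedSpace ℝ V] {s : Set V}
    (hs : Convex ℝ s) {φ : V → ℂ} (hφ : ContinuousOn φ s)
    (h0 : ∀ z ∈ s, φ z ≠ 0) :
    ∃ L : V → ℂ, ContinuousOn L s ∧ ∀ z ∈ s, Complex.exp (L z) = φ z := by
  rcases s.eq_empty_or_nonempty with rfl | ⟨c, hc⟩
  · exact ⟨0, by simp, by simp⟩
  · exact exists_log hc (hs.starConvex hc) hφ h0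

theorem interval_branch {V : Type*} [TopologicalSpace V] {s : Set V} (hs : IsPreconnected s)
    {u : V → ℝ} (hu : ContinuousOn u s) {a b : ℝ} (hab : b < a + 2 * Real.pi)
    (h : ∀ z ∈ s, ∃ n : ℤ, a + 2 * Real.pi * n ≤ u z ∧ u z ≤ b + 2 * Real.pi * n) :
    ∃ n : ℤ, ∀ z ∈ s, a + 2 * Real.pi * n ≤ u z ∧ u z ≤ b + 2 * Real.pi * n := by
  rcases s.eq_empty_or_nonempty with rfl | ⟨c, hc⟩
  · exact ⟨0, by simp⟩
  have hpi := Real.pi_pos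
  obtain ⟨n, hn⟩ := h c hc
  have hoc : (u '' s).OrdConnected := (hs.image u hu).ordConnected
  have avoid : ∀ k : ℤ, ∀ y, b + 2 * Real.pi * k < y → y < a + 2 * Real.pi * (k + 1) →
      y ∉ u '' s := by
    rintro k y h1 h2 ⟨z, hz, rfl⟩
    obtain ⟨m, hm1, hm2⟩ := h z hz
    rcases le_or_gt m k with hmk | hmk
    · have : (m : ℝ) ≤ k := by exact_mod_cast hmk
      nlinarith
    · have : (k : ℝ) + 1 ≤ m := by exact_mod_cast hmk
      nlinarith
  refine ⟨n, fun z hz => ?_⟩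
  constructor
  · by_contra hlt
    push Not at hlt
    obtain ⟨m, hm1, hm2⟩ := h z hz
    have hab' : m ≤ n - 1 := by
      by_contra hmn
      have : (n : ℝ) ≤ m := by exact_mod_cast (by omega : n ≤ m)
      nlinarith
    have hab'' : (m : ℝ) ≤ n - 1 := by exact_mod_cast hab'
    set y := (b + 2 * Real.pi * (n - 1) + (a + 2 * Real.pi * n)) / 2 with hy
    refine avoid (n - 1) y ?_ ?_ (hoc.out ⟨z, hz, rfl⟩ ⟨c, hc, rfl⟩ ⟨?_, ?_⟩)
    · push_cast; linarith
    · push_cast; linarith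
    · nlinarith
    · nlinarith
  · by_contra hlt
    push Not at hlt
    obtain ⟨m, hm1, hm2⟩ := h z hz
    have hab' : n + 1 ≤ m := by
      by_contra hmn
      have : (m : ℝ) ≤ n := by exact_mod_cast (by omega : m ≤ n)
      nlinarith
    have hab'' : (n : ℝ) + 1 ≤ m := by exact_mod_cast hab'
    set y := (b + 2 * Real.pi * n + (a + 2 * Real.pi * (n + 1))) / 2 with hy
    refine avoid n y ?_ ?_ (hoc.out ⟨c, hc, rfl⟩ ⟨z, hz, rfl⟩ ⟨?_, ?_⟩)
    · linarith
    · linarith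
    · nlinarith
    · nlinarith

theorem im_eq_arg (w : ℂ) : ∃ n : ℤ, w.im = (Complex.exp w).arg + 2 * Real.pi * n := by
  have h1 : Complex.exp w = Complex.exp (Complex.log (Complex.exp w)) := by
    rw [Complex.exp_log (Complex.exp_ne_zero w)]
  obtain ⟨n, hn⟩ := Complex.exp_eq_exp_iff_exists_int.1 h1
  refine ⟨n, ?_⟩
  have := congrArg Complex.im hn
  simp [Complex.log_im] at this
  rw [this]; ring

theorem log_diff_const {V : Type*} [TopologicalSpace V] {s : Set V} (hs : IsPreconnected s)
    {L₁ L₂ : V → ℂ} (h1 : ContinuousOn L₁ s) (h2 : ContinuousOn L₂ s)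
    (h : ∀ z ∈ s, Complex.exp (L₁ z) = Complex.exp (L₂ z)) :
    ∃ n : ℤ, ∀ z ∈ s, L₁ z = L₂ z + n * (2 * Real.pi * Complex.I) := by
  obtain ⟨n, hn⟩ := interval_branch (a := 0) (b := 0) hs
    (u := fun z => (L₁ z - L₂ z).im) (Complex.continuous_im.comp_continuousOn (h1.sub h2))
    (by linarith [Real.pi_pos]) (by
      intro z hz
      obtain ⟨n, hn⟩ := im_eq_arg (L₁ z - L₂ z)
      rw [Complex.exp_sub, h z hz, div_self (Complex.exp_ne_zero _), Complex.arg_one] at hn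
      exact ⟨n, hn.ge, hn.le⟩)
  refine ⟨n, fun z hz => ?_⟩
  obtain ⟨ha, hb⟩ := hn z hz
  have e1 : (L₁ z).im = (L₂ z).im + 2 * Real.pi * n := by
    simp at ha hb; linarith
  have e2 : (L₁ z).re = (L₂ z).re := by
    have := congrArg norm (h z hz)
    rw [Complex.norm_exp, Complex.norm_exp] at this
    exact Real.exp_injective this
  apply Complex.ext
  · simp [e2]
  · simp [e1]; ring

end PB

namespace PB

/-- identity plus a contraction is a homeomorphism -/
theorem exists_homeo_add {v : ℂ → ℂ} {K : NNReal} (hK : K < 1) (hv : LipschitzWith K v) :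
    ∃ h : ℂ ≃ₜ ℂ, ∀ x, h x = x + v x := by
  have happ : ApproximatesLinearOn (fun x => x + v x)
      ((ContinuousLinearEquiv.refl ℝ ℂ : ℂ ≃L[ℝ] ℂ) : ℂ →L[ℝ] ℂ) Set.univ K := by
    intro x _ y _
    have := hv.dist_le_mul x y
    rw [dist_eq_norm, dist_eq_norm] at this
    simpa [add_sub_add_comm] using this
  refine ⟨happ.toHomeomorph _ (Or.inr ?_), fun x => rfl⟩
  have : ‖(((ContinuousLinearEquiv.refl ℝ ℂ).symm : ℂ ≃L[ℝ] ℂ) : ℂ →L[ℝ] ℂ)‖₊ = 1 := by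
    have : (((ContinuousLinearEquiv.refl ℝ ℂ).symm : ℂ ≃L[ℝ] ℂ) : ℂ →L[ℝ] ℂ) =
      ContinuousLinearMap.id ℝ ℂ := rfl
    rw [this]
    exact ContinuousLinearMap.nnnorm_id
  rw [this]
  simpa using hK

theorem exists_push {n : ℕ} (a b : Fin n → ℂ) (ρ : ℂ → ℝ) (hρ : LipschitzWith 1 ρ)
    (hρ0 : ∀ x, 0 ≤ ρ x) (hab : ∀ i, ‖b i - a i‖ < ρ (a i) / 8)
    (hnc : ∀ i j, i ≠ j → ∀ t ∈ Set.Icc (0 : ℝ) 1,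
      a i + t * (b i - a i) ≠ a j + t * (b j - a j)) :
    ∃ h : ℂ ≃ₜ ℂ, (∀ i, h (a i) = b i) ∧ ∀ x, ‖h x - x‖ ≤ ρ x / 2 := by
  set p : Fin n → ℝ → ℂ := fun i t => a i + t * (b i - a i) with hp
  have hpos : ∀ i, 0 < ρ (a i) := fun i => by linarith [hab i, norm_nonneg (b i - a i)]
  have hlip : ∀ x y, ρ x ≤ ρ y + ‖x - y‖ := by
    intro x y
    have := hρ.dist_le_mul x y
    rw [Real.dist_eq, dist_eq_norm] at this
    simp at this
    linarith [(abs_le.1 this).2]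
  -- separation radius
  obtain ⟨δ, hδ0, hδ1, hδ2⟩ : ∃ δ : ℝ, 0 < δ ∧ (∀ i, δ < ρ (a i) / 8) ∧
      (∀ i j, i ≠ j → ∀ t ∈ Set.Icc (0 : ℝ) 1, 2 * δ < ‖p i t - p j t‖) := by
    have e1 : ∀ᶠ δ in 𝓝[>] (0 : ℝ), ∀ i, δ < ρ (a i) / 8 := by
      rw [eventually_all]
      intro i
      exact mem_nhdsWithin_of_mem_nhds (Iio_mem_nhds (by linarith [hpos i]))
    have e2 : ∀ᶠ δ in 𝓝[>] (0 : ℝ), ∀ i j, i ≠ j → ∀ t ∈ Set.Icc (0 : ℝ) 1,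
        2 * δ < ‖p i t - p j t‖ := by
      rw [eventually_all]; intro i
      rw [eventually_all]; intro j
      by_cases hij : i = j
      · simp [hij]
      obtain ⟨t0, ht0, hmin⟩ := (isCompact_Icc (a := (0 : ℝ)) (b := 1)).exists_isMinOn
        ⟨0, by simp⟩ (f := fun t => ‖p i t - p j t‖) (by simp only [hp]; fun_prop)
      have hm : 0 < ‖p i t0 - p j t0‖ := norm_pos_iff.2 (sub_ne_zero.2 (hnc i j hij t0 ht0))
      have : ∀ᶠ δ in 𝓝[>] (0 : ℝ), δ < ‖p i t0 - p j t0‖ / 2 :=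
        mem_nhdsWithin_of_mem_nhds (Iio_mem_nhds (by linarith))
      filter_upwards [this] with δ hδ _ t ht
      have := hmin ht
      simp only [Set.mem_ofPred_eq] at this
      linarith
    obtain ⟨δ, h1, h2, h3⟩ := ((eventually_mem_nhdsWithin (a := (0 : ℝ)) (s := Set.Ioi 0)).and
      (e1.and e2)).exists
    exact ⟨δ, h1, h2, h3⟩
  -- bump
  let φ : Fin n → ℝ → ℂ → ℝ := fun i t x => max 0 (1 - ‖x - p i t‖ / δ)
  have φ0 : ∀ i t x, 0 ≤ φ i t x := fun i t x => le_max_left _ _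
  have φ1 : ∀ i t x, φ i t x ≤ 1 := fun i t x =>
    max_le zero_le_one (by have : 0 ≤ ‖x - p i t‖ / δ := by positivity
                           linarith)
  have φz : ∀ i t x, δ ≤ ‖x - p i t‖ → φ i t x = 0 := by
    intro i t x h
    apply max_eq_left
    have : 1 ≤ ‖x - p i t‖ / δ := by rwa [le_div_iff₀ hδ0, one_mul]
    linarith
  have φlip : ∀ i t x y, |φ i t x - φ i t y| ≤ ‖x - y‖ / δ := by
    intro i t x y
    have h1 : |φ i t x - φ i t y| ≤ |(1 - ‖x - p i t‖ / δ) - (1 - ‖y - p i t‖ / δ)| := by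
      simpa [φ] using abs_max_sub_max_le_abs (1 - ‖x - p i t‖ / δ) (1 - ‖y - p i t‖ / δ) 0 |>.trans_eq' (by
        rw [max_comm, max_comm (1 - ‖y - p i t‖ / δ)])
    refine h1.trans ?_
    have : (1 - ‖x - p i t‖ / δ) - (1 - ‖y - p i t‖ / δ) = (‖y - p i t‖ - ‖x - p i t‖) / δ := by ring
    rw [this, abs_div, abs_of_pos hδ0]
    gcongr
    have := abs_norm_sub_norm_le (y - p i t) (x - p i t)
    rw [norm_sub_rev x y]
    simpa using this
  let v : ℝ → ℂ → ℂ := fun t x => ∑ i, (φ i t x : ℂ) * (b i - a i)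
  have vself : ∀ t ∈ Set.Icc (0 : ℝ) 1, ∀ i, v t (p i t) = b i - a i := by
    intro t ht i
    simp only [v]
    rw [Finset.sum_eq_single i]
    · simp [φ]
    · intro j _ hji
      rw [φz j t _ (by linarith [hδ2 i j (Ne.symm hji) t ht])]
      simp
    · simp
  have vbound : ∀ t ∈ Set.Icc (0 : ℝ) 1, ∀ x, ‖v t x‖ ≤ ρ x / 4 := by
    intro t ht x
    by_cases hx : ∃ i, ‖x - p i t‖ < δ
    · obtain ⟨i, hi⟩ := hx
      have : v t x = (φ i t x : ℂ) * (b i - a i) := by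
        simp only [v]
        rw [Finset.sum_eq_single i]
        · intro j _ hji
          have h2 := hδ2 i j (Ne.symm hji) t ht
          have h3 : ‖p i t - p j t‖ ≤ ‖x - p i t‖ + ‖x - p j t‖ := by
            calc ‖p i t - p j t‖ = ‖(x - p j t) - (x - p i t)‖ := by congr 1; ring
              _ ≤ ‖x - p j t‖ + ‖x - p i t‖ := norm_sub_le _ _
              _ = _ := add_comm _ _
          rw [φz j t x (by linarith)]
          simp
        · simp
      rw [this, norm_mul, Complex.norm_real, Real.norm_of_nonneg (φ0 _ _ _)]
      have h4 : φ i t x * ‖b i - a i‖ ≤ ‖b i - a i‖ := by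
        have := mul_le_mul_of_nonneg_right (φ1 i t x) (norm_nonneg (b i - a i))
        linarith
      have h5 : ‖x - a i‖ ≤ δ + ‖b i - a i‖ := by
        calc ‖x - a i‖ = ‖(x - p i t) + t * (b i - a i)‖ := by congr 1; simp only [hp]; ring
          _ ≤ ‖x - p i t‖ + ‖(t : ℂ) * (b i - a i)‖ := norm_add_le _ _
          _ ≤ δ + ‖b i - a i‖ := by
            rw [norm_mul, Complex.norm_real, Real.norm_of_nonneg ht.1]
            have := mul_le_mul_of_nonneg_right ht.2 (norm_nonneg (b i - a i))
            linarith
      have h6 := hlip (a i) x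
      rw [norm_sub_rev] at h6
      linarith [hab i, hδ1 i]
    · push Not at hx
      have : v t x = 0 := by
        simp only [v]
        apply Finset.sum_eq_zero
        intro i _
        rw [φz i t x (hx i)]; simp
      rw [this, norm_zero]; linarith [hρ0 x]
  set K : ℝ := ∑ i, ‖b i - a i‖ / δ with hKdef
  have hK0 : 0 ≤ K := Finset.sum_nonneg (fun i _ => by positivity)
  have vlip : ∀ t x y, ‖v t x - v t y‖ ≤ K * ‖x - y‖ := by
    intro t x y
    simp only [v]
    rw [← Finset.sum_sub_distrib, hKdef, Finset.sum_mul]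
    refine norm_sum_le_of_le _ (fun i _ => ?_)
    rw [← sub_mul, ← Complex.ofReal_sub, norm_mul, Complex.norm_real, Real.norm_eq_abs]
    calc |φ i t x - φ i t y| * ‖b i - a i‖ ≤ (‖x - y‖ / δ) * ‖b i - a i‖ := by
          gcongr; exact φlip i t x y
      _ = ‖b i - a i‖ / δ * ‖x - y‖ := by ring
  obtain ⟨N, hN⟩ := exists_nat_gt (K + 1)
  have hN0 : (0 : ℝ) < N := by linarith
  have kex : ∀ t, ∃ h : ℂ ≃ₜ ℂ, ∀ x, h x = x + v t x / N := by
    intro t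
    refine exists_homeo_add (K := (K / N).toNNReal) ?_ ?_
    · rw [← NNReal.coe_lt_coe]
      rw [Real.coe_toNNReal _ (by positivity), NNReal.coe_one, div_lt_one hN0]; linarith
    · apply LipschitzWith.of_dist_le_mul
      intro x y
      rw [dist_eq_norm, dist_eq_norm, ← sub_div, norm_div]
      rw [Real.coe_toNNReal _ (by positivity), Complex.norm_natCast]
      calc ‖v t x - v t y‖ / N ≤ (K * ‖x - y‖) / N := by gcongr; exact vlip t x y
        _ = K / N * ‖x - y‖ := by ring
  have main : ∀ j : ℕ, j ≤ N → ∃ h : ℂ ≃ₜ ℂ, (∀ i, h (a i) = p i ((j : ℝ) / N)) ∧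
      ∀ x, ‖h x - x‖ ≤ (j / N) * (ρ x / 2) := by
    intro j
    induction j with
    | zero =>
      intro _
      exact ⟨Homeomorph.refl _, by simp [hp], by simp⟩
    | succ j ih =>
      intro hj
      obtain ⟨h, h1, h2⟩ := ih (by omega)
      obtain ⟨k, hk⟩ := kex ((j : ℝ) / N)
      have hjN : (j : ℝ) + 1 ≤ N := by exact_mod_cast hj
      have ht : (j : ℝ) / N ∈ Set.Icc (0 : ℝ) 1 :=
        ⟨by positivity, by rw [div_le_one hN0]; linarith⟩
      refine ⟨h.trans k, ?_, ?_⟩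
      · intro i
        simp only [Homeomorph.trans_apply, h1, hk, vself _ ht]
        simp only [hp]
        have : (N : ℂ) ≠ 0 := by exact_mod_cast hN0.ne'
        push_cast
        field_simp
        ring
      · intro x
        simp only [Homeomorph.trans_apply, hk]
        have h3 := vbound _ ht (h x)
        have h4 := hlip (h x) x
        have h5 := h2 x
        have h6 : (j : ℝ) / N * (ρ x / 2) ≤ ρ x / 2 := by
          have := mul_le_mul_of_nonneg_right ht.2 (by linarith [hρ0 x] : 0 ≤ ρ x / 2)
          linarith
        calc ‖h x + v (j / N) (h x) / N - x‖ = ‖(h x - x) + v (j / N) (h x) / N‖ := by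
              congr 1; ring
          _ ≤ ‖h x - x‖ + ‖v (j / N) (h x) / N‖ := norm_add_le _ _
          _ = ‖h x - x‖ + ‖v (j / N) (h x)‖ / N := by rw [norm_div, Complex.norm_natCast]
          _ ≤ (j / N) * (ρ x / 2) + (ρ x / 2) / N := by
              gcongr
              linarith [hρ0 x]
          _ = _ := by push_cast; ring
  obtain ⟨h, h1, h2⟩ := main N le_rfl
  refine ⟨h, fun i => ?_, fun x => ?_⟩
  · rw [h1, div_self hN0.ne']; simp [hp]
  · have := h2 x
    rwa [div_self hN0.ne', one_mul] at this

end PB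

namespace PB

/-- twist homeomorphisms of the plane, pushing up outside of the strip -/
structure Twist (G : ℂ ≃ₜ ℂ) : Prop where
  hT : ∀ z, G (z + 1) = G z + 1
  hbot : ∀ z : ℂ, z.im ≤ 0 → (G z).im = z.im / 2 ∧ (G z).re < z.re
  htop : ∀ z : ℂ, 1 ≤ z.im → (G z).im = 2 * z.im - 1 ∧ z.re < (G z).re
  hb : ∀ z : ℂ, (G z).im ≤ 0 → z.im ≤ 0
  ht : ∀ z : ℂ, 1 ≤ (G z).im → 1 ≤ z.im
  hrec : ∀ R : Set ℂ, IsOpen R → (∀ z, z + 1 ∈ R ↔ z ∈ R) →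
    (∀ z ∈ R, 0 ≤ z.im → z.im ≤ 1 → G z ∈ R) →
    ∀ z ∈ R, 0 < z.im → z.im < 1 → z ∈ closure (G '' R)
  hfix : {z | G z = z}.Countable

structure Rad (G : ℂ ≃ₜ ℂ) (ρ : ℂ → ℝ) : Prop where
  lip : LipschitzWith 1 ρ
  nonneg : ∀ z, 0 ≤ ρ z
  le4 : ∀ z, ρ z ≤ 1 / 4
  leD : ∀ z, ρ (G z) ≤ ‖G z - z‖
  low : ∀ z : ℂ, z.im ≤ -1 / 4 → ρ z = 0
  pos : ∀ z : ℂ, -1 / 4 < z.im → G z ≠ z → 0 < ρ z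
  per : ∀ z, ρ (z + 1) = ρ z

theorem exists_rad {G : ℂ ≃ₜ ℂ} (hT : ∀ z, G (z + 1) = G z + 1) : ∃ ρ, Rad G ρ := by
  have hTs : ∀ z, G.symm (z + 1) = G.symm z + 1 := by
    intro z
    apply G.injective
    rw [hT]; simp
  set E : Set (ℂ × ℝ) := {q | ‖q.1 - G.symm q.1‖ ≤ q.2} with hE
  have hEc : IsClosed E := isClosed_le (by fun_prop) (by fun_prop)
  have hEn : E.Nonempty := ⟨(0, ‖(0 : ℂ) - G.symm 0‖), by simp [hE]⟩
  set σ : ℂ → ℝ := fun z => Metric.infDist (z, (0 : ℝ)) E with hσ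
  have σlip : LipschitzWith 1 σ := by
    have h0 : LipschitzWith 1 (fun a : ℂ => (a, (0 : ℝ))) := LipschitzWith.prodMk_right (0 : ℝ)
    have h1 := (Metric.lipschitz_infDist_pt E).comp h0
    rw [mul_one] at h1
    exact h1
  have imlip : LipschitzWith 1 (fun z : ℂ => z.im + 1 / 4) := by
    apply LipschitzWith.of_dist_le_mul
    intro x y
    rw [Real.dist_eq, dist_eq_norm]
    simpa using Complex.abs_im_le_norm (x - y)
  refine ⟨fun z => min (σ z) (min (max 0 (z.im + 1 / 4)) (1 / 4)), ?_, ?_, ?_, ?_, ?_, ?_, ?_⟩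
  · have h1 : LipschitzWith 1 (fun z : ℂ => max 0 (z.im + 1 / 4)) := imlip.const_max 0
    have h2 : LipschitzWith 1 (fun z : ℂ => min (max 0 (z.im + 1 / 4)) (1 / 4)) := h1.min_const _
    simpa using σlip.min h2
  · intro z
    exact le_min Metric.infDist_nonneg (le_min (le_max_left _ _) (by norm_num))
  · intro z
    exact (min_le_right _ _).trans (min_le_right _ _)
  · intro z
    refine (min_le_left _ _).trans ?_
    have hm : (G z, ‖G z - z‖) ∈ E := by simp [hE]
    refine (Metric.infDist_le_dist_of_mem hm).trans ?_
    simp [Prod.dist_eq]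
  · intro z hz
    have : max 0 (z.im + 1 / 4) = 0 := max_eq_left (by linarith)
    simp only [this]
    rw [min_eq_left (a := (0 : ℝ)) (by norm_num)]
    exact min_eq_right Metric.infDist_nonneg
  · intro z hz hne
    refine lt_min ?_ (lt_min (lt_max_of_lt_right (by linarith)) (by norm_num))
    rw [← hEc.notMem_iff_infDist_pos hEn]
    simp only [hE, Set.mem_ofPred_eq, not_le, norm_pos_iff, sub_ne_zero]
    intro h
    apply hne
    nth_rewrite 1 [h]; simp
  · intro z
    have h1 : σ (z + 1) = σ z := by
      let Φ : ℂ × ℝ → ℂ × ℝ := fun q => (q.1 + 1, q.2)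
      have hΦ : Isometry Φ := by
        apply Isometry.of_dist_eq
        intro x y; simp [Φ, Prod.dist_eq]
      have hΦE : Φ '' E = E := by
        ext q
        constructor
        · rintro ⟨w, hw, rfl⟩
          simp only [hE, Set.mem_ofPred_eq, Φ] at hw ⊢
          rw [hTs]; simpa using hw
        · intro hq
          refine ⟨(q.1 - 1, q.2), ?_, by simp [Φ]⟩
          simp only [hE, Set.mem_ofPred_eq] at hq ⊢
          have h := hTs (q.1 - 1)
          rw [sub_add_cancel] at h
          rw [h] at hq
          convert hq using 2
          ring
      have := Metric.infDist_image hΦ (x := (z, (0 : ℝ))) (t := E)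
      rw [hΦE] at this
      exact this
    simp [h1]

structure Good (G : ℂ ≃ₜ ℂ) (ρ : ℂ → ℝ) (z : ℕ → ℂ) (n : ℕ) : Prop where
  base : (z 0).im < -1 / 4
  jump : ∀ i < n, ‖z (i + 1) - G (z i)‖ < ρ (G (z i)) / 8
  nofix : ∀ i ≤ n, G (z i) ≠ z i
  inj : ∀ i j, i < j → j ≤ n → z i ≠ z j
  nc : ∀ i j, i < j → j < n → ∀ t ∈ Set.Icc (0 : ℝ) 1,
    G (z i) + t * (z (i + 1) - G (z i)) ≠ G (z j) + t * (z (j + 1) - G (z j))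

def reach (G : ℂ ≃ₜ ℂ) (ρ : ℂ → ℝ) : Set ℂ := {w | ∃ z n, Good G ρ z n ∧ z n = w}

theorem Good.step {G : ℂ ≃ₜ ℂ} {ρ : ℂ → ℝ} {z : ℕ → ℂ} {n : ℕ}
    (hfix : {z | G z = z}.Countable) (h : Good G ρ z n) :
    Metric.ball (G (z n)) (ρ (G (z n)) / 8) ⊆ closure (reach G ρ) := by
  set Z : Set ℂ := ({z | G z = z} ∪ Set.range z) ∪
    ⋃ i : ℕ, Set.range (fun s : ℝ => z (i + 1) + s * (G (z i) - G (z n))) with hZ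
  have hdim : dimH Z ≤ 1 := by
    rw [hZ, dimH_union]
    refine max_le ?_ ?_
    · rw [(hfix.union (Set.countable_range z)).dimH_zero]; exact zero_le
    · rw [dimH_iUnion]
      refine iSup_le fun i => ?_
      have hl : LipschitzWith ‖G (z i) - G (z n)‖₊
          (fun s : ℝ => z (i + 1) + s * (G (z i) - G (z n))) := by
        apply LipschitzWith.of_dist_le_mul
        intro x y
        rw [dist_eq_norm, dist_eq_norm]
        have : (z (i + 1) + x * (G (z i) - G (z n))) - (z (i + 1) + y * (G (z i) - G (z n)))
          = ((x - y : ℝ) : ℂ) * (G (z i) - G (z n)) := by push_cast; ring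
        rw [this, norm_mul, Complex.norm_real, mul_comm]
        simp
      refine hl.dimH_range_le.trans ?_
      rw [Real.dimH_univ]
  have hdense : Dense Zᶜ := by
    apply dense_compl_of_dimH_lt_finrank
    rw [Complex.finrank_real_complex]
    exact hdim.trans_lt (by norm_num)
  refine (hdense.open_subset_closure_inter Metric.isOpen_ball).trans (closure_mono ?_)
  rintro w ⟨hw, hwZ⟩
  have hw1 : G w ≠ w := fun hh => hwZ (Or.inl (Or.inl hh))
  have hw2 : ∀ i, z i ≠ w := fun i hh => hwZ (Or.inl (Or.inr ⟨i, hh⟩))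
  have hw3 : ∀ i (s : ℝ), z (i + 1) + s * (G (z i) - G (z n)) ≠ w := fun i s hh =>
    hwZ (Or.inr (Set.mem_iUnion.2 ⟨i, s, hh⟩))
  set z' : ℕ → ℂ := fun i => if i ≤ n then z i else w with hz'
  have z'1 : ∀ i, i ≤ n → z' i = z i := fun i hi => by simp [hz', hi]
  have z'2 : z' (n + 1) = w := by simp [hz']
  refine ⟨z', n + 1, ⟨?_, ?_, ?_, ?_, ?_⟩, z'2⟩
  · rw [z'1 0 (by omega)]; exact h.base
  · intro i hi
    rcases Nat.lt_succ_iff_lt_or_eq.1 hi with hi | rfl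
    · rw [z'1 i hi.le, z'1 (i + 1) hi]; exact h.jump i hi
    · rw [z'1 i le_rfl, z'2]
      simpa [dist_eq_norm] using hw
  · intro i hi
    rcases Nat.le_succ_iff.1 hi with hi | rfl
    · rw [z'1 i hi]; exact h.nofix i hi
    · rw [z'2]; exact hw1
  · intro i j hij hj
    rcases Nat.le_succ_iff.1 hj with hj | rfl
    · rw [z'1 i (by omega), z'1 j hj]; exact h.inj i j hij hj
    · rw [z'2, z'1 i (by omega)]; exact hw2 i
  · intro i j hij hj t ht
    rcases Nat.lt_succ_iff_lt_or_eq.1 hj with hj | rfl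
    · rw [z'1 i (by omega), z'1 (i + 1) (by omega), z'1 j (by omega), z'1 (j + 1) (by omega)]
      exact h.nc i j hij hj t ht
    · rw [z'1 i (by omega), z'1 (i + 1) (by omega), z'1 j (by omega), z'2]
      intro heq
      by_cases ht0 : t = 0
      · subst ht0
        simp at heq
        exact h.inj i j hij le_rfl heq
      · apply hw3 i ((1 - t) / t)
        have ht0' : (t : ℂ) ≠ 0 := by exact_mod_cast ht0
        push_cast
        field_simp
        linear_combination heq

theorem Good.translate {G : ℂ ≃ₜ ℂ} {ρ : ℂ → ℝ} {c : ℂ} (hc : c.im = 0)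
    (hG : ∀ z, G (z + c) = G z + c) (hρ : ∀ z, ρ (z + c) = ρ z) {z : ℕ → ℂ} {n : ℕ}
    (h : Good G ρ z n) : Good G ρ (fun i => z i + c) n := by
  refine ⟨?_, ?_, ?_, ?_, ?_⟩
  · simpa [hc] using h.base
  · intro i hi
    simpa [hG, hρ] using h.jump i hi
  · intro i hi
    simpa [hG] using h.nofix i hi
  · intro i j hij hj
    simpa using h.inj i j hij hj
  · intro i j hij hj t ht heq
    apply h.nc i j hij hj t ht
    simp only [hG] at heq
    linear_combination heq

theorem exists_good {G : ℂ ≃ₜ ℂ} (tw : Twist G) {ρ : ℂ → ℝ} (hρ : Rad G ρ) :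
    ∃ z n, Good G ρ z n ∧ 2 < (z n).im := by
  by_contra hcon
  set R' := reach G ρ with hR'
  have hR2 : ∀ w ∈ R', w.im ≤ 2 := by
    rintro w ⟨z, n, hg, rfl⟩
    by_contra h
    exact hcon ⟨z, n, hg, not_le.1 h⟩
  set C := closure R' with hC
  set U := interior C with hU
  have hbase : {w : ℂ | w.im < -1 / 4} ⊆ R' := by
    intro w hw
    refine ⟨fun _ => w, 0, ⟨hw, by simp, ?_, by omega, by omega⟩, rfl⟩
    intro i _ heq
    have hw' : w.im < -1 / 4 := hw
    have := (tw.hbot w (by linarith)).2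
    rw [heq] at this
    exact lt_irrefl _ this
  have nofix : ∀ w ∈ R', G w ≠ w := by
    rintro w ⟨z, n, hg, rfl⟩
    exact hg.nofix n le_rfl
  have hball : ∀ w ∈ R', Metric.ball (G w) (ρ (G w) / 8) ⊆ C := by
    rintro w ⟨z, n, hg, rfl⟩
    exact hg.step tw.hfix
  have hGR : ∀ w ∈ R', G w ∈ C := by
    intro w hw
    by_cases h : (G w).im ≤ -1 / 4
    · have h2 : G w ∈ closure {w : ℂ | w.im < -1 / 4} := by
        rw [Complex.closure_setOfPred_im_lt]; exact h
      exact closure_mono hbase h2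
    · push Not at h
      have := hρ.pos (G w) h (fun hh => nofix w hw (G.injective hh))
      exact hball w hw (Metric.mem_ball_self (by linarith))
  have hGC : ∀ w ∈ C, G w ∈ C := by
    intro w hw
    have : Set.MapsTo G R' C := hGR
    have h2 := this.closure G.continuous
    rw [isClosed_closure.closure_eq] at h2
    exact h2 hw
  have hGU : ∀ w ∈ U, G w ∈ U := by
    intro w hw
    have h1 : IsOpen (G '' U) := G.isOpenMap _ isOpen_interior
    have h2 : G '' U ⊆ C := by
      rintro _ ⟨v, hv, rfl⟩; exact hGC v (interior_subset hv)
    exact interior_maximal h2 h1 ⟨w, hw, rfl⟩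
  have hTs : ∀ z, G (z + (-1)) = G z + (-1) := by
    intro z
    have := tw.hT (z + (-1))
    rw [neg_add_cancel_right] at this
    rw [this]; ring
  have hρs : ∀ z, ρ (z + (-1)) = ρ z := by
    intro z
    have := hρ.per (z + (-1))
    rw [neg_add_cancel_right] at this
    exact this.symm
  have hRT : ∀ z, z ∈ R' → z + 1 ∈ R' := by
    rintro _ ⟨z, n, hg, rfl⟩
    exact ⟨_, n, hg.translate (c := 1) (by simp) tw.hT hρ.per, rfl⟩
  have hRT' : ∀ z, z ∈ R' → z + (-1) ∈ R' := by
    rintro _ ⟨z, n, hg, rfl⟩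
    exact ⟨_, n, hg.translate (c := -1) (by simp) hTs hρs, rfl⟩
  have hUT : ∀ c : ℂ, (∀ z, z ∈ R' → z + c ∈ R') → ∀ z, z ∈ U → z + c ∈ U := by
    intro c hc z hz
    have hcC : ∀ z ∈ C, z + c ∈ C := by
      intro w hw
      have : Set.MapsTo (fun z => z + c) R' R' := hc
      exact (this.closure (by fun_prop)) hw
    have h1 : IsOpen ((Homeomorph.addRight c) '' U) :=
      (Homeomorph.addRight c).isOpenMap _ isOpen_interior
    have h2 : (Homeomorph.addRight c) '' U ⊆ C := by
      rintro _ ⟨v, hv, rfl⟩; exact hcC v (interior_subset hv)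
    exact interior_maximal h2 h1 ⟨z, hz, rfl⟩
  have hbU : ∀ k : ℕ, ∀ z : ℂ, z.im < -1 / 4 / 2 ^ k → z ∈ U := by
    intro k
    induction k with
    | zero =>
      intro z hz
      have : IsOpen {w : ℂ | w.im < -1 / 4} := isOpen_lt Complex.continuous_im continuous_const
      exact interior_maximal (hbase.trans subset_closure) this (by simpa using hz)
    | succ k ih =>
      intro z hz
      have hneg : -1 / 4 / 2 ^ (k + 1) < (0 : ℝ) := by
        apply div_neg_of_neg_of_pos (by norm_num) (by positivity)
      have h1 : (G.symm z).im ≤ 0 := tw.hb _ (by simp; linarith)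
      have h2 := (tw.hbot _ h1).1
      simp only [Homeomorph.apply_symm_apply] at h2
      have h3 : G.symm z ∈ U := by
        apply ih
        have : (-1 / 4 / 2 ^ k : ℝ) = 2 * (-1 / 4 / 2 ^ (k + 1)) := by
          rw [pow_succ]; field_simp
        rw [this]; linarith
      simpa using hGU _ h3
  have hlow : ∀ z : ℂ, z.im < 0 → z ∈ U := by
    intro z hz
    obtain ⟨k, hk⟩ := exists_pow_lt_of_lt_one (show 0 < -z.im by linarith)
      (show (1 / 2 : ℝ) < 1 by norm_num)
    apply hbU k
    rw [div_pow, one_pow] at hk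
    have : (-1 / 4 / 2 ^ k : ℝ) = -(1 / 4) * (1 / 2 ^ k) := by ring
    rw [this]
    have h2 : (0 : ℝ) < 1 / 2 ^ k := by positivity
    nlinarith
  -- upper bounds
  have hC2 : ∀ w ∈ C, w.im ≤ 2 := by
    intro w hw
    have hcl : IsClosed {w : ℂ | w.im ≤ 2} := isClosed_le Complex.continuous_im continuous_const
    exact closure_minimal (show R' ⊆ {w : ℂ | w.im ≤ 2} from hR2) hcl hw
  have hCk : ∀ k : ℕ, ∀ w ∈ C, w.im - 1 ≤ 1 / 2 ^ k := by
    intro k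
    induction k with
    | zero => intro w hw; have := hC2 w hw; simp; linarith
    | succ k ih =>
      intro w hw
      by_cases h1 : 1 ≤ w.im
      · have h2 := ih _ (hGC w hw)
        rw [(tw.htop w h1).1] at h2
        have : (1 / 2 ^ k : ℝ) = 2 * (1 / 2 ^ (k + 1)) := by
          rw [pow_succ]; field_simp
        rw [this] at h2; linarith
      · have : (0 : ℝ) < 1 / 2 ^ (k + 1) := by positivity
        linarith
  have hC1 : ∀ w ∈ C, w.im ≤ 1 := by
    intro w hw
    by_contra h
    obtain ⟨k, hk⟩ := exists_pow_lt_of_lt_one (show 0 < w.im - 1 by linarith)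
      (show (1 / 2 : ℝ) < 1 by norm_num)
    rw [div_pow, one_pow] at hk
    linarith [hCk k w hw]
  have hU1 : ∀ w ∈ U, w.im < 1 := by
    intro w hw
    have : w ∈ interior {w : ℂ | w.im ≤ 1} := interior_mono (show C ⊆ {w : ℂ | w.im ≤ 1} from hC1) hw
    rw [Complex.interior_setOfPred_im_le] at this
    exact this
  have hUG : U ⊆ closure (G '' U) := by
    have hneg : {w : ℂ | w.im < 0} ⊆ G '' U := by
      intro z hz
      have hz' : z.im < 0 := hz
      have h1 : (G.symm z).im ≤ 0 := tw.hb _ (by simp; linarith)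
      have h2 := (tw.hbot _ h1).1
      simp only [Homeomorph.apply_symm_apply] at h2
      exact ⟨G.symm z, hlow _ (by linarith), by simp⟩
    intro z hz
    rcases le_or_gt z.im 0 with h0 | h0
    · apply closure_mono hneg
      rw [Complex.closure_setOfPred_im_lt]; exact h0
    · refine tw.hrec U isOpen_interior ?_ (fun w hw _ _ => hGU w hw) z hz h0 (hU1 z hz)
      intro z
      constructor
      · intro h
        have := hUT (-1) hRT' _ h
        simpa using this
      · exact hUT 1 hRT z
  have hclU : closure U ∩ {z | G z = z}ᶜ ⊆ U := by
    rintro w ⟨hw, hwf⟩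
    have hwf' : G w ≠ w := hwf
    by_cases h0 : w.im < 0
    · exact hlow w h0
    have hpos := hρ.pos w (by linarith) hwf'
    have h1 : w ∈ closure (G '' R') := by
      have h2 : G '' U ⊆ closure (G '' R') := by
        refine (Set.image_mono interior_subset).trans ?_
        exact image_closure_subset_closure_image G.continuous
      have h3 : closure (G '' U) ⊆ closure (G '' R') := closure_minimal h2 isClosed_closure
      exact closure_minimal (hUG.trans h3) isClosed_closure hw
    have hO : IsOpen {v : ℂ | ‖w - v‖ < ρ v / 8} :=
      isOpen_lt (by fun_prop) (by have := hρ.lip.continuous; fun_prop)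
    obtain ⟨v, hv1, ⟨u, hu, rfl⟩⟩ := mem_closure_iff.1 h1 _ hO (by simp; linarith)
    refine interior_maximal (hball u hu) Metric.isOpen_ball ?_
    simpa [dist_eq_norm] using hv1
  have hconn : IsPreconnected ({z | G z = z}ᶜ) :=
    (tw.hfix.isConnected_compl_of_one_lt_rank (by
      rw [Complex.rank_real_complex]; norm_num)).isPreconnected
  have hsub := hconn.subset_of_closure_inter_subset isOpen_interior
    ⟨-Complex.I, by
      have := (tw.hbot (-Complex.I) (by simp)).2
      intro h
      have h' : G (-Complex.I) = -Complex.I := h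
      rw [h'] at this; exact lt_irrefl _ this, hlow _ (by simp)⟩ hclU
  have h3 : (3 * Complex.I) ∈ U := by
    apply hsub
    intro h
    have h' : G (3 * Complex.I) = 3 * Complex.I := h
    have := (tw.htop (3 * Complex.I) (by simp)).2
    rw [h'] at this; exact lt_irrefl _ this
  have := hU1 _ h3
  norm_num at this

end PB

namespace PB

/-- perturbed homeomorphism with a long orbit going up -/
structure Chain (G g : ℂ ≃ₜ ℂ) (z₀ : ℂ) (n : ℕ) : Prop where
  h1 : ∀ x, ‖g x - G x‖ ≤ ‖G x - x‖ / 2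
  h2 : ∀ x, ‖g x - G x‖ ≤ 1 / 8
  h3 : ∀ x, (G x).im ≤ -1 / 4 → g x = G x
  h4 : ∀ x, (g x).im ≤ -1 / 4 → g x = G x
  base : z₀.im < -1 / 4
  top : 2 < (g^[n] z₀).im

theorem exists_chain {G : ℂ ≃ₜ ℂ} (tw : Twist G) : ∃ g z₀ n, Chain G g z₀ n := by
  obtain ⟨ρ, hρ⟩ := exists_rad tw.hT
  obtain ⟨z, n, hg, hn⟩ := exists_good tw hρ
  obtain ⟨h, hh1, hh2⟩ := exists_push (n := n) (fun i => G (z i)) (fun i => z (i + 1)) ρ hρ.lip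
    hρ.nonneg (fun i => hg.jump i i.2) (by
      intro i j hij t ht
      rcases lt_or_gt_of_ne hij with h | h
      · exact hg.nc i j h j.2 t ht
      · exact (hg.nc j i h i.2 t ht).symm)
  have hlow : ∀ x : ℂ, x.im ≤ -1 / 4 → h x = x := by
    intro x hx
    have := hh2 x
    rw [hρ.low x hx] at this
    have h3 : ‖h x - x‖ = 0 := le_antisymm (by linarith) (norm_nonneg _)
    exact sub_eq_zero.1 (norm_eq_zero.1 h3)
  refine ⟨G.trans h, z 0, n, ?_, ?_, ?_, ?_, hg.base, ?_⟩
  · intro x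
    have := hh2 (G x)
    have h3 := hρ.leD x
    simp only [Homeomorph.trans_apply]
    linarith
  · intro x
    have := hh2 (G x)
    have h3 := hρ.le4 (G x)
    simp only [Homeomorph.trans_apply]
    linarith
  · intro x hx
    exact hlow _ hx
  · intro x hx
    simp only [Homeomorph.trans_apply] at hx ⊢
    exact h.injective (hlow _ hx)
  · have key : ∀ i ≤ n, (G.trans h)^[i] (z 0) = z i := by
      intro i
      induction i with
      | zero => intro _; rfl
      | succ i ih =>
        intro hi
        rw [Function.iterate_succ_apply', ih (by omega)]
        exact hh1 ⟨i, hi⟩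
    rw [key n le_rfl]; exact hn

/-- the path -/
noncomputable def path (g : ℂ ≃ₜ ℂ) (q r : ℂ) (t : ℝ) : ℂ :=
  g^[⌊t⌋₊] (q + ((t - ⌊t⌋₊ : ℝ) : ℂ) * (r - q))

theorem path_eq (g : ℂ ≃ₜ ℂ) {q r : ℂ} (hr : g q = r) (n : ℕ) {t : ℝ} (h1 : n = 0 ∨ (n : ℝ) ≤ t)
    (h2 : t ≤ n + 1) : path g q r t = g^[n] (q + ((t - n : ℝ) : ℂ) * (r - q)) := by
  rcases h2.lt_or_eq with h2 | rfl
  · have : ⌊t⌋₊ = n := by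
      rcases h1 with rfl | h1
      · rw [Nat.floor_eq_zero]; simpa using h2
      · rw [Nat.floor_eq_iff (le_trans (by positivity) h1)]; exact ⟨h1, h2⟩
    simp only [path, this]
  · have : ⌊(n : ℝ) + 1⌋₊ = n + 1 := by exact_mod_cast Nat.floor_natCast (R := ℝ) (n + 1)
    simp only [path, this]
    rw [Function.iterate_succ_apply]
    congr 1
    push_cast
    simp [hr]

theorem path_continuous (g : ℂ ≃ₜ ℂ) {q r : ℂ} (hr : g q = r) : Continuous (path g q r) := by
  refine LocallyFinite.continuous (f := fun n : ℕ => {t : ℝ | (n = 0 ∨ (n : ℝ) ≤ t) ∧ t ≤ n + 1})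
    ?_ ?_ ?_ ?_
  · intro x
    refine ⟨Set.Iio (x + 1), Iio_mem_nhds (by linarith), ?_⟩
    refine (Set.finite_Iic ⌊x + 1⌋₊).subset ?_
    rintro n ⟨t, ⟨h1, h2⟩, h3⟩
    rcases h1 with rfl | h1
    · simp
    · have h3' : t < x + 1 := h3
      exact Nat.le_floor (by linarith)
  · refine Set.eq_univ_of_forall fun t => Set.mem_iUnion.2 ?_
    refine ⟨⌊t⌋₊, ?_, (Nat.lt_floor_add_one t).le⟩
    rcases le_or_gt 0 t with h | h
    · right; exact Nat.floor_le h
    · left; exact Nat.floor_of_nonpos h.le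
  · intro n
    have h1 : IsClosed {t : ℝ | n = 0 ∨ (n : ℝ) ≤ t} := by
      by_cases hn : n = 0
      · simp [hn]
      · simp only [hn, false_or]
        exact isClosed_le continuous_const continuous_id
    exact h1.inter (isClosed_le continuous_id continuous_const)
  · intro n
    have hc : Continuous (fun t : ℝ => g^[n] (q + ((t - n : ℝ) : ℂ) * (r - q))) :=
      (g.continuous.iterate n).comp (by fun_prop)
    exact hc.continuousOn.congr fun t ht => path_eq g hr n ht.1 ht.2

theorem path_add (g : ℂ ≃ₜ ℂ) {q r : ℂ} (m : ℕ) {t : ℝ} (ht : 0 ≤ t) :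
    path g q r (t + m) = g^[m] (path g q r t) := by
  have : ⌊t + m⌋₊ = m + ⌊t⌋₊ := by rw [Nat.floor_add_natCast ht, add_comm]
  simp only [path, this]
  rw [Function.iterate_add_apply]
  congr 3
  push_cast; ring

theorem arg_branch {s x : ℝ} {K J : ℤ} (h1 : -(Real.pi / 2) + 2 * Real.pi * K ≤ x)
    (h2 : x ≤ 3 * Real.pi / 2 + 2 * Real.pi * K) (hx : x = s + 2 * Real.pi * J)
    (hs1 : 0 < s) (hs2 : s < Real.pi) : J = K := by
  have hpi := Real.pi_pos
  have e1 : (J : ℝ) < K + 1 := by nlinarith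
  have e2 : (K : ℝ) < J + 1 := by nlinarith
  have e1' : J < K + 1 := by exact_mod_cast e1
  have e2' : K < J + 1 := by exact_mod_cast e2
  omega

theorem key {G : ℂ ≃ₜ ℂ} (tw : Twist G) {l : ℂ → ℂ} (hl : ContinuousOn l {z | G z ≠ z})
    (hle : ∀ z, G z ≠ z → Complex.exp (l z) = G z - z) :
    ∃ (K : ℤ) (q w : ℂ), q.im < 0 ∧ 1 < w.im ∧
      (Real.pi / 2 + 2 * Real.pi * K ≤ (l q).im ∧ (l q).im ≤ Real.pi + 2 * Real.pi * K) ∧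
      (0 + 2 * Real.pi * K ≤ (l w).im ∧ (l w).im ≤ Real.pi / 2 + 2 * Real.pi * K) := by
  have hpi := Real.pi_pos
  obtain ⟨g, z₀, n, hc⟩ := exists_chain tw
  have hz0 := hc.base
  set q := G.symm z₀ with hq
  have hGq : G q = z₀ := by simp [hq]
  have hgq : g q = z₀ := by rw [hc.h3 q (by rw [hGq]; exact hz0.le), hGq]
  have hq0 : q.im ≤ 0 := tw.hb q (by rw [hGq]; linarith)
  have hqim : z₀.im = q.im / 2 := by rw [← hGq]; exact (tw.hbot q hq0).1
  have hqre : z₀.re < q.re := by rw [← hGq]; exact (tw.hbot q hq0).2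
  set γ := path g q z₀ with hγ
  have γc : Continuous γ := path_continuous g hgq
  have γadd : ∀ (m : ℕ) (t : ℝ), 0 ≤ t → γ (t + m) = g^[m] (γ t) := fun m t ht => path_add g m ht
  have γ1 : ∀ t : ℝ, 0 ≤ t → γ (t + 1) = g (γ t) := by
    intro t ht
    simpa using γadd 1 t ht
  have γlow : ∀ t : ℝ, t ≤ 1 → γ t = q + (t : ℂ) * (z₀ - q) := by
    intro t ht
    simpa using path_eq g hgq 0 (t := t) (Or.inl rfl) (by simpa using ht)
  have γlowim : ∀ t : ℝ, t ≤ 1 → (γ t).im = q.im * (1 - t / 2) := by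
    intro t ht
    rw [γlow t ht]
    simp [hqim]; ring
  have up : ∀ w : ℂ, q.im ≤ w.im → q.im / 2 ≤ (g w).im := by
    intro w hw
    by_contra hcon
    push Not at hcon
    have e1 := hc.h4 w (by linarith)
    rw [e1] at hcon
    have e2 := tw.hb w (by linarith)
    have e3 := (tw.hbot w e2).1
    linarith
  have γge : ∀ (k : ℕ) (t : ℝ), 0 ≤ t → t ≤ k + 1 → q.im ≤ (γ t).im := by
    intro k
    induction k with
    | zero =>
      intro t h0 h1
      rw [γlowim t (by simpa using h1)]
      nlinarith
    | succ k ih =>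
      intro t h0 h1
      rcases le_or_gt t 1 with h | h
      · rw [γlowim t h]; nlinarith
      · have e := γ1 (t - 1) (by linarith)
        rw [sub_add_cancel] at e
        rw [e]
        have := up _ (ih (t - 1) (by linarith) (by push_cast at h1; linarith))
        linarith
  have γge' : ∀ t : ℝ, 0 ≤ t → q.im ≤ (γ t).im := by
    intro t ht
    exact γge ⌊t⌋₊ t ht (Nat.lt_floor_add_one t).le
  have γge1 : ∀ t : ℝ, 1 ≤ t → q.im / 2 ≤ (γ t).im := by
    intro t ht
    have e := γ1 (t - 1) (by linarith)
    rw [sub_add_cancel] at e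
    rw [e]
    exact up _ (γge' _ (by linarith))
  have γne : ∀ s t : ℝ, 0 ≤ s → s + 1 ≤ t → γ t ≠ γ s := by
    intro s t hs hst heq
    set m := ⌊s⌋₊ with hm
    have hm1 : (m : ℝ) ≤ s := Nat.floor_le hs
    have hm2 : s < m + 1 := Nat.lt_floor_add_one s
    have e1 := γadd m (s - m) (by linarith)
    have e2 := γadd m (t - m) (by linarith)
    rw [sub_add_cancel] at e1 e2
    rw [e1, e2] at heq
    have e3 := g.injective.iterate m heq
    have e4 := γge1 (t - m) (by linarith)
    rw [e3, γlowim _ (by linarith)] at e4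
    nlinarith
  have γn : γ (n + 1) = g^[n] z₀ := by
    have e1 := γadd n 1 zero_le_one
    rw [add_comm] at e1
    rw [e1, γlow 1 le_rfl]
    simp
  obtain ⟨T, hT1, hT2⟩ := (isCompact_Icc (a := (0 : ℝ)) (b := n + 1)).exists_isMaxOn
    ⟨0, by constructor <;> positivity⟩ (f := fun t => (γ t).im)
    (Complex.continuous_im.comp γc).continuousOn
  have hTm : ∀ t : ℝ, 0 ≤ t → t ≤ n + 1 → (γ t).im ≤ (γ T).im := fun t h1 h2 => hT2 ⟨h1, h2⟩
  have hT3 : 2 < (γ T).im := by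
    have := hTm (n + 1) (by positivity) le_rfl
    rw [γn] at this
    linarith [hc.top]
  have imd : ∀ x, |(g x).im - (G x).im| ≤ 1 / 8 := by
    intro x
    have := Complex.abs_im_le_norm (g x - G x)
    rw [Complex.sub_im] at this
    exact this.trans (hc.h2 x)
  have hTn : (n : ℝ) < T := by
    by_contra hcon
    push Not at hcon
    have e1 := hTm (T + 1) (by linarith [hT1.1]) (by linarith)
    rw [γ1 T hT1.1] at e1
    have e2 := abs_le.1 (imd (γ T))
    have e3 := (tw.htop (γ T) (by linarith)).1
    linarith [e2.1]
  have hn1 : 1 ≤ n := by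
    by_contra hcon
    have : n = 0 := by omega
    have h2 := hc.top
    rw [this] at h2
    simp at h2
    linarith
  have hT4 : 1 < T := by
    have : (1 : ℝ) ≤ n := by exact_mod_cast hn1
    linarith
  set w := γ (T - 1) with hw
  have hgw : g w = γ T := by
    rw [hw, ← γ1 _ (by linarith), sub_add_cancel]
  have hw1 : 1 < w.im := by
    have e2 := abs_le.1 (imd w)
    rw [hgw] at e2
    have e3 := tw.ht w (by linarith [e2.2])
    have e4 := (tw.htop w e3).1
    linarith [e2.2]
  -- the logarithm on the triangle
  set S : Set (ℝ × ℝ) := {p | 0 ≤ p.1 ∧ p.1 + 1 ≤ p.2 ∧ p.2 ≤ T} with hS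
  have Sconv : Convex ℝ S := by
    rintro ⟨a1, a2⟩ ⟨h1, h2, h3⟩ ⟨b1, b2⟩ ⟨h4, h5, h6⟩ u v hu hv huv
    simp only at h1 h2 h3 h4 h5 h6
    refine ⟨?_, ?_, ?_⟩ <;> simp only [Prod.smul_mk, Prod.mk_add_mk, smul_eq_mul]
    · positivity
    · nlinarith
    · nlinarith
  obtain ⟨L, hL1, hL2⟩ := exists_log_convex Sconv (φ := fun p => γ p.2 - γ p.1)
    (by fun_prop) (fun p hp => sub_ne_zero.2 (γne p.1 p.2 hp.1 hp.2.1))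
  -- edges
  set E1 : Set (ℝ × ℝ) := {0} ×ˢ Set.Icc 1 T with hE1
  set E2 : Set (ℝ × ℝ) := Set.Icc 0 (T - 1) ×ˢ {T} with hE2
  have hE : IsPreconnected (E1 ∪ E2) := by
    refine IsPreconnected.union (0, T) ?_ ?_ ?_ ?_
    · simp [hE1]; linarith
    · simp [hE2]; linarith
    · exact (isPreconnected_singleton).prod isPreconnected_Icc
    · exact isPreconnected_Icc.prod isPreconnected_singleton
  have hES : E1 ∪ E2 ⊆ S := by
    rintro ⟨a, b⟩ (⟨h1, h2⟩ | ⟨h1, h2⟩)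
    · simp only [Set.mem_singleton_iff, Set.mem_Icc] at h1 h2
      subst h1
      exact ⟨le_rfl, by simpa using h2.1, h2.2⟩
    · simp only [Set.mem_singleton_iff, Set.mem_Icc] at h1 h2
      subst h2
      exact ⟨h1.1, by simp only; linarith [h1.2], le_rfl⟩
  obtain ⟨k, hk⟩ := interval_branch hE (u := fun p => (L p).im) (a := 0) (b := Real.pi)
    (Complex.continuous_im.comp_continuousOn (hL1.mono hES)) (by linarith) (by
      intro p hp
      obtain ⟨j, hj⟩ := im_eq_arg (L p)
      rw [hL2 p (hES hp)] at hj
      have h1 : 0 ≤ (γ p.2 - γ p.1).arg := by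
        rw [Complex.arg_nonneg_iff, Complex.sub_im, sub_nonneg]
        have hpS := hES hp
        rcases hp with ⟨h1, h2⟩ | ⟨h1, h2⟩
        · rw [Set.mem_singleton_iff.1 h1]
          have : (γ 0).im = q.im := by rw [γlowim 0 zero_le_one]; simp
          rw [this]
          exact γge' _ (by linarith [h2.1])
        · rw [Set.mem_singleton_iff.1 h2]
          exact hTm _ h1.1 (by linarith [h1.2, hT1.2])
      have h2 := Complex.arg_le_pi (γ p.2 - γ p.1)
      exact ⟨j, by linarith, by linarith⟩)
  -- diagonal
  have γnf : ∀ s : ℝ, 0 ≤ s → G (γ s) ≠ γ s := by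
    intro s hs hf
    have e1 := hc.h1 (γ s)
    rw [hf] at e1
    have e2 : g (γ s) = γ s := by
      apply sub_eq_zero.1
      apply norm_eq_zero.1
      refine le_antisymm ?_ (norm_nonneg _)
      simpa using e1
    exact γne s (s + 1) hs le_rfl ((γ1 s hs).trans e2)
  have hdS : ∀ s ∈ Set.Icc (0 : ℝ) (T - 1), (s, s + 1) ∈ S := by
    intro s hs
    exact ⟨hs.1, le_rfl, by simp only; linarith [hs.2]⟩
  obtain ⟨m, hm⟩ := interval_branch (isPreconnected_Icc (a := (0 : ℝ)) (b := T - 1))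
    (u := fun s => (L (s, s + 1) - l (γ s)).im) (a := -(Real.pi / 2)) (b := Real.pi / 2)
    (by
      refine Complex.continuous_im.comp_continuousOn (ContinuousOn.sub ?_ ?_)
      · exact hL1.comp (by fun_prop) hdS
      · exact hl.comp γc.continuousOn (fun s hs => γnf s hs.1)) (by linarith) (by
      intro s hs
      obtain ⟨j, hj⟩ := im_eq_arg (L (s, s + 1) - l (γ s))
      rw [Complex.exp_sub, hL2 _ (hdS s hs), hle _ (γnf s hs.1)] at hj
      simp only [γ1 s hs.1] at hj
      have hre : 0 ≤ ((g (γ s) - γ s) / (G (γ s) - γ s)).re := by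
        have hne := sub_ne_zero.2 (γnf s hs.1)
        have e1 : (g (γ s) - γ s) / (G (γ s) - γ s) = 1 + (g (γ s) - G (γ s)) / (G (γ s) - γ s) := by
          field_simp; ring
        have e2 : ‖(g (γ s) - G (γ s)) / (G (γ s) - γ s)‖ ≤ 1 / 2 := by
          rw [norm_div, div_le_iff₀ (norm_pos_iff.2 hne)]
          linarith [hc.h1 (γ s)]
        have e3 := (abs_le.1 ((Complex.abs_re_le_norm _).trans e2)).1
        rw [e1, Complex.add_re, Complex.one_re]
        linarith
      have := abs_le.1 (Complex.abs_arg_le_pi_div_two_iff.2 hre)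
      exact ⟨j, by linarith [this.1], by linarith [this.2]⟩)
  -- conclusion
  have hqnf : G q ≠ q := by
    intro h; rw [hGq] at h; rw [h] at hqre; exact lt_irrefl _ hqre
  have hwre := (tw.htop w hw1.le).2
  have hwim := (tw.htop w hw1.le).1
  have hwnf : G w ≠ w := by
    intro h; rw [h] at hwre; exact lt_irrefl _ hwre
  have γ0 : γ 0 = q := by rw [γlow 0 zero_le_one]; simp
  obtain ⟨j1, hj1⟩ := im_eq_arg (l q)
  obtain ⟨j2, hj2⟩ := im_eq_arg (l w)
  rw [hle q hqnf] at hj1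
  rw [hle w hwnf] at hj2
  have a1 : Real.pi / 2 < (G q - q).arg := by
    by_contra hcon
    push Not at hcon
    rcases Complex.arg_le_pi_div_two_iff.1 hcon with h | h
    · rw [hGq, Complex.sub_re] at h; linarith
    · rw [hGq, Complex.sub_im] at h; linarith
  have a2 : (G q - q).arg < Real.pi := by
    refine lt_of_le_of_ne (Complex.arg_le_pi _) ?_
    intro h
    have := (Complex.arg_eq_pi_iff.1 h).2
    rw [hGq, Complex.sub_im] at this; linarith
  have a3 : 0 < (G w - w).arg := by
    refine lt_of_le_of_ne ?_ ?_
    · rw [Complex.arg_nonneg_iff, Complex.sub_im]; linarith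
    · intro h
      have := (Complex.arg_eq_zero_iff.1 h.symm).2
      rw [Complex.sub_im] at this; linarith
  have a4 : (G w - w).arg ≤ Real.pi / 2 := by
    rw [Complex.arg_le_pi_div_two_iff]; left
    rw [Complex.sub_re]; linarith
  have b1 := hm 0 ⟨le_rfl, by linarith⟩
  have b2 := hm (T - 1) ⟨by linarith, le_rfl⟩
  have b3 := hk (0, 0 + 1) (Or.inl ⟨rfl, by simp; linarith⟩)
  have b4 := hk (T - 1, T - 1 + 1) (Or.inr ⟨⟨by simp only; linarith, le_rfl⟩, by simp⟩)
  simp only [Complex.sub_im, γ0, zero_add] at b1 b2 b3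
  rw [← hw] at b2
  have c1 : j1 = k - m := by
    apply arg_branch (x := (l q).im) (s := (G q - q).arg) _ _ hj1 (by linarith) a2 <;> push_cast <;>
      linarith [b1.1, b1.2, b3.1, b3.2]
  have c2 : j2 = k - m := by
    apply arg_branch (x := (l w).im) (s := (G w - w).arg) _ _ hj2 a3 (by linarith) <;> push_cast <;>
      linarith [b2.1, b2.2, b4.1, b4.2]
  refine ⟨k - m, q, w, by linarith, hw1, ?_, ?_⟩
  · rw [c1] at hj1
    constructor <;> linarith
  · rw [c2] at hj2
    constructor <;> linarith

end PB

namespace PB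

/-- recurrence property coming from area preservation -/
def Rec (G : ℂ ≃ₜ ℂ) : Prop := ∀ R : Set ℂ, IsOpen R → (∀ z, z + 1 ∈ R ↔ z ∈ R) →
    (∀ z ∈ R, 0 ≤ z.im → z.im ≤ 1 → G z ∈ R) →
    ∀ z ∈ R, 0 < z.im → z.im < 1 → z ∈ closure (G '' R)

/-- standard extension to the plane of the lift -/
structure Std (G : ℂ ≃ₜ ℂ) : Prop where
  hT : ∀ z, G (z + 1) = G z + 1
  hbot : ∀ z : ℂ, z.im ≤ 0 → (G z).im = z.im ∧ (G z).re < z.re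
  htop : ∀ z : ℂ, 1 ≤ z.im → (G z).im = z.im ∧ z.re < (G z).re
  hb : ∀ z : ℂ, (G z).im ≤ 0 → z.im ≤ 0
  ht : ∀ z : ℂ, 1 ≤ (G z).im → 1 ≤ z.im
  hrec : Rec G
  hfix : {z | G z = z}.Countable

noncomputable def pp (y : ℝ) : ℝ := max (max y (2 * y - 1)) (y / 2)
noncomputable def pq (y : ℝ) : ℝ := min (min y ((y + 1) / 2)) (2 * y)

theorem pp_bot {y : ℝ} (h : y ≤ 0) : pp y = y / 2 := by
  unfold pp
  rw [max_eq_right]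
  exact max_le (by linarith) (by linarith)
theorem pp_mid {y : ℝ} (h : 0 ≤ y) (h1 : y ≤ 1) : pp y = y := by
  unfold pp
  rw [max_eq_left (a := y) (by linarith), max_eq_left (by linarith)]
theorem pp_top {y : ℝ} (h : 1 ≤ y) : pp y = 2 * y - 1 := by
  unfold pp
  rw [max_eq_right (a := y) (by linarith), max_eq_left (by linarith)]
theorem pq_bot {y : ℝ} (h : y ≤ 0) : pq y = 2 * y := by
  unfold pq
  rw [min_eq_right]
  exact le_min (by linarith) (by linarith)
theorem pq_mid {y : ℝ} (h : 0 ≤ y) (h1 : y ≤ 1) : pq y = y := by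
  unfold pq
  rw [min_eq_left (a := y) (by linarith), min_eq_left (by linarith)]
theorem pq_top {y : ℝ} (h : 1 ≤ y) : pq y = (y + 1) / 2 := by
  unfold pq
  rw [min_eq_right (a := y) (by linarith), min_eq_left (by linarith)]
theorem pq_pp (y : ℝ) : pq (pp y) = y := by
  rcases le_total y 0 with h | h
  · rw [pp_bot h, pq_bot (by linarith)]; ring
  · rcases le_total y 1 with h1 | h1
    · rw [pp_mid h h1, pq_mid h h1]
    · rw [pp_top h1, pq_top (by linarith)]; ring
theorem pp_pq (y : ℝ) : pp (pq y) = y := by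
  rcases le_total y 0 with h | h
  · rw [pq_bot h, pp_bot (by linarith)]; ring
  · rcases le_total y 1 with h1 | h1
    · rw [pq_mid h h1, pp_mid h h1]
    · rw [pq_top h1, pp_top (by linarith)]; ring

noncomputable def PP : ℂ ≃ₜ ℂ where
  toFun z := (z.re : ℂ) + (pp z.im : ℂ) * Complex.I
  invFun z := (z.re : ℂ) + (pq z.im : ℂ) * Complex.I
  left_inv z := by apply Complex.ext <;> simp [pq_pp]
  right_inv z := by apply Complex.ext <;> simp [pp_pq]
  continuous_toFun := by unfold pp; fun_prop
  continuous_invFun := by unfold pq; fun_prop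

theorem PP_re (z : ℂ) : (PP z).re = z.re := by simp [PP]
theorem PP_im (z : ℂ) : (PP z).im = pp z.im := by simp [PP]
theorem PP_mid {z : ℂ} (h : 0 ≤ z.im) (h1 : z.im ≤ 1) : PP z = z := by
  apply Complex.ext
  · rw [PP_re]
  · rw [PP_im, pp_mid h h1]

theorem Std.strip {G : ℂ ≃ₜ ℂ} (st : Std G) {z : ℂ} (h : 0 ≤ z.im) (h1 : z.im ≤ 1) :
    0 ≤ (G z).im ∧ (G z).im ≤ 1 := by
  constructor
  · by_contra hc
    push Not at hc
    have e1 := st.hb z hc.le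
    have e2 := (st.hbot z e1).1
    linarith
  · by_contra hc
    push Not at hc
    have e1 := st.ht z hc.le
    have e2 := (st.htop z e1).1
    linarith

theorem Std.nofix_bot {G : ℂ ≃ₜ ℂ} (st : Std G) {z : ℂ} (h : z.im ≤ 0) : G z ≠ z := by
  intro h1
  have := (st.hbot z h).2
  rw [h1] at this
  exact lt_irrefl _ this

theorem Std.nofix_top {G : ℂ ≃ₜ ℂ} (st : Std G) {z : ℂ} (h : 1 ≤ z.im) : G z ≠ z := by
  intro h1
  have := (st.htop z h).2
  rw [h1] at this
  exact lt_irrefl _ this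

theorem Std.hat_fix {G : ℂ ≃ₜ ℂ} (st : Std G) (z : ℂ) : PP (G z) = z ↔ G z = z := by
  rcases le_total z.im 0 with h | h
  · refine ⟨fun h1 => ?_, fun h1 => absurd h1 (st.nofix_bot h)⟩
    have := (st.hbot z h).2
    rw [← PP_re, h1] at this
    exact absurd this (lt_irrefl _)
  · rcases le_total z.im 1 with h1 | h1
    · rw [PP_mid (st.strip h h1).1 (st.strip h h1).2]
    · refine ⟨fun h2 => ?_, fun h2 => absurd h2 (st.nofix_top h1)⟩
      have := (st.htop z h1).2
      rw [← PP_re (G z), h2] at this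
      exact absurd this (lt_irrefl _)

theorem Std.twist {G : ℂ ≃ₜ ℂ} (st : Std G) : Twist (G.trans PP) where
  hT z := by
    apply Complex.ext <;> simp [st.hT, PP_re, PP_im]
  hbot z hz := by
    obtain ⟨h1, h2⟩ := st.hbot z hz
    simp only [Homeomorph.trans_apply, PP_re, PP_im]
    exact ⟨by rw [h1, pp_bot hz], h2⟩
  htop z hz := by
    obtain ⟨h1, h2⟩ := st.htop z hz
    simp only [Homeomorph.trans_apply, PP_re, PP_im]
    exact ⟨by rw [h1, pp_top hz], h2⟩
  hb z hz := by
    simp only [Homeomorph.trans_apply, PP_im] at hz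
    exact st.hb z (le_trans ((le_max_left _ _).trans (le_max_left _ _)) hz)
  ht z hz := by
    simp only [Homeomorph.trans_apply, PP_im] at hz
    apply st.ht z
    by_contra hc
    push Not at hc
    have : pp (G z).im < 1 := max_lt (max_lt hc (by linarith)) (by linarith)
    linarith
  hrec R hR hp hf z hz h0 h1 := by
    have h2 := st.hrec R hR hp (fun w hw hw0 hw1 => by
      have := hf w hw hw0 hw1
      rwa [Homeomorph.trans_apply, PP_mid (st.strip hw0 hw1).1 (st.strip hw0 hw1).2] at this)
      z hz h0 h1
    have h3 : PP z ∈ closure (PP '' (G '' R)) :=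
      image_closure_subset_closure_image PP.continuous ⟨z, h2, rfl⟩
    rw [PP_mid h0.le h1.le, ← Set.image_comp] at h3
    exact h3
  hfix := by
    have : {z | (G.trans PP) z = z} = {z | G z = z} := by
      ext z; exact st.hat_fix z
    rw [this]; exact st.hfix

theorem Std.lift {G : ℂ ≃ₜ ℂ} (st : Std G) {l : ℂ → ℂ} (hl : ContinuousOn l {z | G z ≠ z})
    (hle : ∀ z, G z ≠ z → Complex.exp (l z) = G z - z) :
    ∃ K : ℤ, (∀ z : ℂ, z.im ≤ 0 → (l z).im = Real.pi + 2 * Real.pi * K) ∧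
      (∀ z : ℂ, 1 ≤ z.im → (l z).im = 2 * Real.pi * K) := by
  have hpi := Real.pi_pos
  have hhat : ∀ z, PP (G z) ≠ z ↔ G z ≠ z := fun z => not_congr (st.hat_fix z)
  set r : ℂ → ℂ := fun z => (PP (G z) - z) / (G z - z) with hr
  have hre : ∀ z, G z ≠ z → (r z).re = 1 := by
    intro z hz
    have aux : (G z).im = z.im → (r z).re = 1 := by
      intro h
      have hd : G z - z = (((G z).re - z.re : ℝ) : ℂ) := by
        apply Complex.ext <;> simp [h]
      have hd0 : (G z).re - z.re ≠ 0 := by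
        intro h0; rw [h0] at hd
        exact hz (sub_eq_zero.1 (by simpa using hd))
      simp only [hr]
      rw [hd, Complex.div_ofReal_re, Complex.sub_re, PP_re, div_self hd0]
    rcases le_total z.im 0 with h | h
    · exact aux (st.hbot z h).1
    · rcases le_total z.im 1 with h1 | h1
      · simp only [hr]
        rw [PP_mid (st.strip h h1).1 (st.strip h h1).2, div_self (sub_ne_zero.2 hz)]
        simp
      · exact aux (st.htop z h1).1
  have hr0 : ∀ z, G z ≠ z → r z ≠ 0 := by
    intro z hz h
    have := hre z hz
    rw [h] at this; simp at this
  obtain ⟨K, q, w, hq, hw, ⟨k1, k2⟩, k3, k4⟩ := key st.twist (l := fun z => l z + Complex.log (r z))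
    (by
      have : {z | (G.trans PP) z ≠ z} = {z | G z ≠ z} := by
        ext z; exact hhat z
      rw [this]
      refine hl.add (ContinuousOn.clog ?_ ?_)
      · refine ContinuousOn.div ?_ ?_ (fun z hz => sub_ne_zero.2 hz)
        · have := PP.continuous; have := G.continuous; fun_prop
        · have := G.continuous; fun_prop
      · intro z hz
        left; rw [hre z hz]; norm_num)
    (by
      intro z hz
      have hz' := (hhat z).1 hz
      rw [Complex.exp_add, Complex.exp_log (hr0 z hz'), hle z hz']
      simp only [hr]
      rw [mul_div_cancel₀ _ (sub_ne_zero.2 hz')]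
      rfl)
  have harg : ∀ z, G z ≠ z → -(Real.pi / 2) < (r z).arg ∧ (r z).arg < Real.pi / 2 := by
    intro z hz
    rw [← abs_lt, Complex.abs_arg_lt_pi_div_two_iff]
    left; rw [hre z hz]; norm_num
  have hbot : ∀ z : ℂ, z.im ≤ 0 → ∃ n : ℤ, (l z).im = Real.pi + 2 * Real.pi * n := by
    intro z hz
    obtain ⟨n, hn⟩ := im_eq_arg (l z)
    rw [hle z (st.nofix_bot hz)] at hn
    refine ⟨n, ?_⟩
    rw [hn]
    congr 1
    rw [Complex.arg_eq_pi_iff]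
    obtain ⟨h1, h2⟩ := st.hbot z hz
    constructor <;> simp <;> linarith
  have htop : ∀ z : ℂ, 1 ≤ z.im → ∃ n : ℤ, (l z).im = 0 + 2 * Real.pi * n := by
    intro z hz
    obtain ⟨n, hn⟩ := im_eq_arg (l z)
    rw [hle z (st.nofix_top hz)] at hn
    refine ⟨n, ?_⟩
    rw [hn]
    congr 1
    rw [Complex.arg_eq_zero_iff]
    obtain ⟨h1, h2⟩ := st.htop z hz
    constructor <;> simp <;> linarith
  obtain ⟨n1, hn1⟩ := interval_branch (s := {z : ℂ | z.im ≤ 0}) (u := fun z => (l z).im)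
    (a := Real.pi) (b := Real.pi) (convex_halfSpace_im_le 0).isPreconnected
    (Complex.continuous_im.comp_continuousOn (hl.mono fun z hz => st.nofix_bot hz))
    (by linarith) (fun z hz => by
      obtain ⟨n, hn⟩ := hbot z hz
      exact ⟨n, hn.ge, hn.le⟩)
  obtain ⟨n2, hn2⟩ := interval_branch (s := {z : ℂ | 1 ≤ z.im}) (u := fun z => (l z).im)
    (a := 0) (b := 0) (convex_halfSpace_im_ge 1).isPreconnected
    (Complex.continuous_im.comp_continuousOn (hl.mono fun z hz => st.nofix_top hz))
    (by linarith) (fun z hz => by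
      obtain ⟨n, hn⟩ := htop z hz
      exact ⟨n, hn.ge, hn.le⟩)
  have c1 := hn1 q hq.le
  have c2 := hn2 w hw.le
  have d1 := harg q (st.nofix_bot hq.le)
  have d2 := harg w (st.nofix_top hw.le)
  simp only [Complex.add_im, Complex.log_im] at k1 k2 k3 k4
  have e1 : n1 = K := by
    have f1 : (n1 : ℝ) < K + 1 := by nlinarith
    have f2 : (K : ℝ) < n1 + 1 := by nlinarith
    have f1' : n1 < K + 1 := by exact_mod_cast f1
    have f2' : K < n1 + 1 := by exact_mod_cast f2
    omega
  have e2 : n2 = K := by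
    have f1 : (n2 : ℝ) < K + 1 := by nlinarith
    have f2 : (K : ℝ) < n2 + 1 := by nlinarith
    have f1' : n2 < K + 1 := by exact_mod_cast f1
    have f2' : K < n2 + 1 := by exact_mod_cast f2
    omega
  subst e1
  subst e2
  refine ⟨n2, fun z hz => ?_, fun z hz => ?_⟩
  · have := hn1 z hz; linarith
  · have := hn2 z hz; linarith

noncomputable def RR : ℂ ≃ₜ ℂ where
  toFun z := -(starRingEnd ℂ) z
  invFun z := -(starRingEnd ℂ) z
  left_inv z := by simp
  right_inv z := by simp
  continuous_toFun := by fun_prop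
  continuous_invFun := by fun_prop

theorem RR_apply (z : ℂ) : RR z = -(starRingEnd ℂ) z := rfl
theorem RR_re (z : ℂ) : (RR z).re = -z.re := by simp [RR_apply]
theorem RR_im (z : ℂ) : (RR z).im = z.im := by simp [RR_apply]
theorem RR_RR (z : ℂ) : RR (RR z) = z := by simp [RR_apply]
theorem RR_add (z : ℂ) : RR (z + 1) = RR z - 1 := by simp [RR_apply]; ring

noncomputable def flip (G : ℂ ≃ₜ ℂ) : ℂ ≃ₜ ℂ := RR.trans (G.symm.trans RR)

theorem flip_apply (G : ℂ ≃ₜ ℂ) (z : ℂ) : flip G z = RR (G.symm (RR z)) := rfl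

theorem flip_fix (G : ℂ ≃ₜ ℂ) (z : ℂ) : flip G z = z ↔ G (G.symm (RR z)) = G.symm (RR z) := by
  rw [flip_apply, Homeomorph.apply_symm_apply]
  constructor
  · intro h
    rw [← RR_RR (G.symm (RR z)), h]
  · intro h
    rw [← h, RR_RR]

theorem Std.flip {G : ℂ ≃ₜ ℂ} (st : Std G) (hrec : Rec G.symm) : Std (flip G) := by
  have sb : ∀ w : ℂ, w.im ≤ 0 → (G.symm w).im = w.im ∧ w.re < (G.symm w).re := by
    intro w hw
    have h1 := st.hb (G.symm w) (by simpa using hw)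
    have h2 := st.hbot _ h1
    simp only [Homeomorph.apply_symm_apply] at h2
    exact ⟨h2.1.symm, h2.2⟩
  have stt : ∀ w : ℂ, 1 ≤ w.im → (G.symm w).im = w.im ∧ (G.symm w).re < w.re := by
    intro w hw
    have h1 := st.ht (G.symm w) (by simpa using hw)
    have h2 := st.htop _ h1
    simp only [Homeomorph.apply_symm_apply] at h2
    exact ⟨h2.1.symm, h2.2⟩
  have hTs : ∀ z, G.symm (z - 1) = G.symm z - 1 := by
    intro z
    apply G.injective
    have := st.hT (G.symm z - 1)
    rw [sub_add_cancel] at this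
    simp only [Homeomorph.apply_symm_apply] at this ⊢
    linear_combination this
  refine ⟨?_, ?_, ?_, ?_, ?_, ?_, ?_⟩
  · intro z
    rw [flip_apply, flip_apply, RR_add, hTs]
    have := RR_add (G.symm (RR z) - 1)
    rw [sub_add_cancel] at this
    rw [this]; ring
  · intro z hz
    rw [flip_apply, RR_re, RR_im]
    have := sb (RR z) (by rwa [RR_im])
    rw [RR_im, RR_re] at this
    exact ⟨this.1, by linarith [this.2]⟩
  · intro z hz
    rw [flip_apply, RR_re, RR_im]
    have := stt (RR z) (by rwa [RR_im])
    rw [RR_im, RR_re] at this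
    exact ⟨this.1, by linarith [this.2]⟩
  · intro z hz
    rw [flip_apply, RR_im] at hz
    have := (st.hbot _ hz).1
    rw [Homeomorph.apply_symm_apply, RR_im] at this
    rw [this]; exact hz
  · intro z hz
    rw [flip_apply, RR_im] at hz
    have := (st.htop _ hz).1
    rw [Homeomorph.apply_symm_apply, RR_im] at this
    rw [this]; exact hz
  · intro R hR hp hf z hz h0 h1
    have hS : RR ⁻¹' R = RR '' R := by
      ext w
      constructor
      · intro h; exact ⟨RR w, h, RR_RR w⟩
      · rintro ⟨v, hv, rfl⟩; simpa [RR_RR] using hv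
    have key := hrec (RR ⁻¹' R) (hR.preimage RR.continuous) (by
      intro w
      simp only [Set.mem_preimage, RR_add]
      have := hp (RR w - 1)
      rw [sub_add_cancel] at this
      exact this.symm) (by
      intro w hw hw0 hw1
      have := hf (RR w) hw (by rwa [RR_im]) (by rwa [RR_im])
      rw [flip_apply, RR_RR] at this
      exact this) (RR z) (by simpa [RR_RR] using hz) (by rwa [RR_im]) (by rwa [RR_im])
    have h3 : RR (RR z) ∈ closure (RR '' (G.symm '' (RR ⁻¹' R))) :=
      image_closure_subset_closure_image RR.continuous ⟨_, key, rfl⟩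
    rw [RR_RR, hS, ← Set.image_comp, ← Set.image_comp] at h3
    exact h3
  · have : {z | PB.flip G z = z} = (RR.trans G.symm) ⁻¹' {z | G z = z} := by
      ext z; exact flip_fix G z
    rw [this]
    exact st.hfix.preimage (RR.trans G.symm).injective

theorem Std.false {G : ℂ ≃ₜ ℂ} (st : Std G) (hrec : Rec G.symm) {l : ℂ → ℂ}
    (hl : ContinuousOn l {z | G z ≠ z})
    (hle : ∀ z, G z ≠ z → Complex.exp (l z) = G z - z) : False := by
  obtain ⟨K, hK1, hK2⟩ := st.lift hl hle
  have st' := st.flip hrec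
  have hne : ∀ z, PB.flip G z ≠ z → G (G.symm (RR z)) ≠ G.symm (RR z) := fun z =>
    (not_congr (flip_fix G z)).1
  obtain ⟨K', hK1', hK2'⟩ := st'.lift (l := fun z => (starRingEnd ℂ) (l (G.symm (RR z))))
    (by
      refine Complex.continuous_conj.comp_continuousOn (hl.comp ?_ (fun z hz => hne z hz))
      exact (G.symm.continuous.comp RR.continuous).continuousOn)
    (by
      intro z hz
      rw [Complex.exp_conj, hle _ (hne z hz), Homeomorph.apply_symm_apply, flip_apply, RR_apply z,
        RR_apply (G.symm _)]
      simp; ring)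
  have a1 := hK1' (RR (G 0)) (by rw [RR_im, (st.hbot 0 (by simp)).1]; simp)
  have a2 := hK2' (RR (G Complex.I)) (by rw [RR_im, (st.htop Complex.I (by simp)).1]; simp)
  simp only [RR_RR, Homeomorph.symm_apply_apply, Complex.conj_im] at a1 a2
  rw [hK1 0 (by simp)] at a1
  rw [hK2 Complex.I (by simp)] at a2
  linarith [Real.pi_pos]

end PB

namespace PB

theorem plog {φ : ℂ → ℂ} {s s0 : Set ℂ} (hs : Convex ℝ s) (hs1 : ∀ z ∈ s, z + 1 ∈ s)
    (h0s : s0 ⊆ s) (hs0 : Convex ℝ s0) (hs01 : ∀ z ∈ s0, z + 1 ∈ s0) (hne : s0.Nonempty)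
    (hφ : ContinuousOn φ s) (hφ0 : ∀ z ∈ s, φ z ≠ 0) (hφ1 : ∀ z, φ (z + 1) = φ z) {a : ℝ}
    (ha : ∀ z ∈ s0, (φ z).arg = a) :
    ∃ L : ℂ → ℂ, ContinuousOn L s ∧ (∀ z ∈ s, Complex.exp (L z) = φ z) ∧
      ∀ z ∈ s, L (z + 1) = L z := by
  obtain ⟨L, hL1, hL2⟩ := exists_log_convex hs hφ hφ0
  refine ⟨L, hL1, hL2, ?_⟩
  obtain ⟨n, hn⟩ := log_diff_const hs.isPreconnected (L₁ := fun z => L (z + 1)) (L₂ := L)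
    (hL1.comp (by fun_prop) hs1) hL1 (fun z hz => by
      simp only [hL2 z hz, hL2 _ (hs1 z hz), hφ1])
  obtain ⟨k, hk⟩ := interval_branch hs0.isPreconnected (u := fun z => (L z).im) (a := a) (b := a)
    (Complex.continuous_im.comp_continuousOn (hL1.mono h0s)) (by linarith [Real.pi_pos])
    (fun z hz => by
      obtain ⟨n, hn⟩ := im_eq_arg (L z)
      rw [hL2 z (h0s hz), ha z hz] at hn
      exact ⟨n, hn.ge, hn.le⟩)
  obtain ⟨c, hc⟩ := hne
  have e1 := hk c hc
  have e2 := hk (c + 1) (hs01 c hc)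
  have e3 := congrArg Complex.im (hn c (h0s hc))
  simp at e3
  have e4 : (n : ℝ) * (2 * Real.pi) = 0 := by linarith
  have e5 : n = 0 := by
    have := Real.pi_pos
    rcases mul_eq_zero.1 e4 with h | h
    · exact_mod_cast h
    · linarith
  intro z hz
  have := hn z hz
  simpa [e5] using this

theorem per_int {L : ℂ → ℂ} {s : Set ℂ} (hs : ∀ z, z + 1 ∈ s ↔ z ∈ s)
    (h : ∀ z ∈ s, L (z + 1) = L z) (n : ℤ) : ∀ z ∈ s, L (z - n) = L z ∧ z - n ∈ s := by
  have hm : ∀ z ∈ s, L (z - 1) = L z ∧ z - 1 ∈ s := by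
    intro z hz
    have h1 : z - 1 ∈ s := by
      rw [← hs, sub_add_cancel]; exact hz
    have := h (z - 1) h1
    rw [sub_add_cancel] at this
    exact ⟨this.symm, h1⟩
  induction n using Int.induction_on with
  | zero => intro z hz; simpa using hz
  | succ i ih =>
    intro z hz
    obtain ⟨h1, h2⟩ := ih z hz
    obtain ⟨h3, h4⟩ := hm _ h2
    have e : z - ((i : ℤ) + 1 : ℤ) = z - (i : ℤ) - 1 := by push_cast; ring
    rw [e]
    exact ⟨h3.trans h1, h4⟩
  | pred i ih =>
    intro z hz
    obtain ⟨h1, h2⟩ := ih z hz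
    have e : z - (-(i : ℤ) - 1 : ℤ) = z - (-(i : ℤ) : ℤ) + 1 := by push_cast; ring
    rw [e]
    exact ⟨(h _ h2).trans h1, (hs _).2 h2⟩

theorem Std.exists_l {G : ℂ ≃ₜ ℂ} (st : Std G) {z₀ : ℂ} (hz₀ : G z₀ = z₀)
    (hfix : ∀ z, G z = z → ∃ n : ℤ, z = z₀ + n) :
    ∃ l : ℂ → ℂ, ContinuousOn l {z | G z ≠ z} ∧ ∀ z, G z ≠ z → Complex.exp (l z) = G z - z := by
  classical
  set φ : ℂ → ℂ := fun z => G z - z with hφ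
  have φc : Continuous φ := by have := G.continuous; fun_prop
  have φ1 : ∀ z, φ (z + 1) = φ z := by intro z; simp [hφ, st.hT]
  have hGm : ∀ (n : ℤ) z, φ (z - n) = φ z := by
    intro n z
    exact (per_int (L := φ) (s := Set.univ) (by simp) (fun z _ => φ1 z) n z trivial).1
  set B : Set ℂ := {z | z.im < z₀.im} with hB
  set T : Set ℂ := {z | z₀.im < z.im} with hT
  set C : Set ℂ := {z | z₀.re < z.re} ∩ {z | z.re < z₀.re + 1} with hC
  have Bc : Convex ℝ B := convex_halfSpace_im_lt _
  have Tc : Convex ℝ T := convex_halfSpace_im_gt _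
  have Cc : Convex ℝ C := (convex_halfSpace_re_gt _).inter (convex_halfSpace_re_lt _)
  have Bo : IsOpen B := isOpen_lt Complex.continuous_im continuous_const
  have To : IsOpen T := isOpen_lt continuous_const Complex.continuous_im
  have Co : IsOpen C := (isOpen_lt continuous_const Complex.continuous_re).inter
    (isOpen_lt Complex.continuous_re continuous_const)
  have B0 : ∀ z ∈ B, φ z ≠ 0 := by
    intro z hz h
    obtain ⟨n, rfl⟩ := hfix z (sub_eq_zero.1 h)
    simp [hB] at hz
  have T0 : ∀ z ∈ T, φ z ≠ 0 := by
    intro z hz h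
    obtain ⟨n, rfl⟩ := hfix z (sub_eq_zero.1 h)
    simp [hT] at hz
  have C0 : ∀ z ∈ C, φ z ≠ 0 := by
    intro z hz h
    obtain ⟨n, rfl⟩ := hfix z (sub_eq_zero.1 h)
    obtain ⟨h1, h2⟩ := hz
    simp at h1 h2
    have h2' : n < 1 := by exact_mod_cast h2
    omega
  obtain ⟨LC, C1, C2⟩ := exists_log_convex Cc φc.continuousOn C0
  have B1iff : ∀ z, z + 1 ∈ B ↔ z ∈ B := by intro z; simp [hB]
  have T1iff : ∀ z, z + 1 ∈ T ↔ z ∈ T := by intro z; simp [hT]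
  have hB' : ∃ L : ℂ → ℂ, ContinuousOn L B ∧ (∀ z ∈ B, Complex.exp (L z) = φ z) ∧
      (∀ z ∈ B, L (z + 1) = L z) ∧ ∀ z ∈ B ∩ C, L z = LC z := by
    obtain ⟨L, h1, h2, h3⟩ := plog (φ := φ) (s := B) (s0 := {z | z.im ≤ 0} ∩ B) Bc
      (fun z hz => (B1iff z).2 hz) Set.inter_subset_right ((convex_halfSpace_im_le _).inter Bc)
      (fun z hz => ⟨by simpa using hz.1, (B1iff z).2 hz.2⟩)
      ⟨((min 0 (z₀.im - 1) : ℝ) : ℂ) * Complex.I, by simp, by simp [hB]⟩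
      φc.continuousOn B0 φ1 (a := Real.pi) (by
        rintro z ⟨hz, -⟩
        rw [Complex.arg_eq_pi_iff]
        obtain ⟨h1, h2⟩ := st.hbot z hz
        constructor <;> simp [hφ] <;> linarith)
    obtain ⟨n, hn⟩ := log_diff_const (Bc.inter Cc).isPreconnected (L₁ := L) (L₂ := LC)
      (h1.mono Set.inter_subset_left) (C1.mono Set.inter_subset_right)
      (fun z hz => by rw [h2 z hz.1, C2 z hz.2])
    refine ⟨fun z => L z - n * (2 * Real.pi * Complex.I), h1.sub continuousOn_const, ?_, ?_, ?_⟩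
    · intro z hz
      rw [Complex.exp_sub, h2 z hz, Complex.exp_int_mul_two_pi_mul_I, div_one]
    · intro z hz; simp only [h3 z hz]
    · intro z hz; simp only [hn z hz]; ring
  have hT' : ∃ L : ℂ → ℂ, ContinuousOn L T ∧ (∀ z ∈ T, Complex.exp (L z) = φ z) ∧
      (∀ z ∈ T, L (z + 1) = L z) ∧ ∀ z ∈ T ∩ C, L z = LC z := by
    obtain ⟨L, h1, h2, h3⟩ := plog (φ := φ) (s := T) (s0 := {z | 1 ≤ z.im} ∩ T) Tc
      (fun z hz => (T1iff z).2 hz) Set.inter_subset_right ((convex_halfSpace_im_ge _).inter Tc)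
      (fun z hz => ⟨by simpa using hz.1, (T1iff z).2 hz.2⟩)
      ⟨((max 1 (z₀.im + 1) : ℝ) : ℂ) * Complex.I, by simp, by simp [hT]⟩
      φc.continuousOn T0 φ1 (a := 0) (by
        rintro z ⟨hz, -⟩
        rw [Complex.arg_eq_zero_iff]
        obtain ⟨h1, h2⟩ := st.htop z hz
        constructor <;> simp [hφ] <;> linarith)
    obtain ⟨n, hn⟩ := log_diff_const (Tc.inter Cc).isPreconnected (L₁ := L) (L₂ := LC)
      (h1.mono Set.inter_subset_left) (C1.mono Set.inter_subset_right)
      (fun z hz => by rw [h2 z hz.1, C2 z hz.2])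
    refine ⟨fun z => L z - n * (2 * Real.pi * Complex.I), h1.sub continuousOn_const, ?_, ?_, ?_⟩
    · intro z hz
      rw [Complex.exp_sub, h2 z hz, Complex.exp_int_mul_two_pi_mul_I, div_one]
    · intro z hz; simp only [h3 z hz]
    · intro z hz; simp only [hn z hz]; ring
  obtain ⟨LB, B1, B2, B3, B4⟩ := hB'
  obtain ⟨LT, T1, T2, T3, T4⟩ := hT'
  set l : ℂ → ℂ := fun z => if z.im < z₀.im then LB z else if z₀.im < z.im then LT z else
    LC (z - (⌊z.re - z₀.re⌋ : ℤ)) with hl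
  have lB : ∀ z ∈ B, l z = LB z := by
    intro z hz
    have hz' : z.im < z₀.im := hz
    simp [hl, hz']
  have lT : ∀ z ∈ T, l z = LT z := by
    intro z hz
    have hz' : z₀.im < z.im := hz
    simp [hl, hz', hz'.not_gt]
  have lC : ∀ (m : ℤ) (z : ℂ), z - m ∈ C → l z = LC (z - m) := by
    intro m z hz
    rcases lt_trichotomy z.im z₀.im with h | h | h
    · obtain ⟨e1, e2⟩ := per_int B1iff B3 m z h
      rw [lB z h, ← e1, B4 _ ⟨e2, hz⟩]
    · have : ⌊z.re - z₀.re⌋ = m := by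
        rw [Int.floor_eq_iff]
        obtain ⟨h1, h2⟩ := hz
        simp at h1 h2
        constructor <;> linarith
      simp [hl, h, this]
    · obtain ⟨e1, e2⟩ := per_int T1iff T3 m z h
      rw [lT z h, ← e1, T4 _ ⟨e2, hz⟩]
  have inC : ∀ z : ℂ, z.im = z₀.im → G z ≠ z → ∃ m : ℤ, z - m ∈ C := by
    intro z him hz
    refine ⟨⌊z.re - z₀.re⌋, ?_, ?_⟩
    · simp only [Set.mem_ofPred_eq, Complex.sub_re, Complex.intCast_re]
      have h1 := Int.floor_le (z.re - z₀.re)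
      refine lt_of_le_of_ne (by linarith) ?_
      intro heq
      apply hz
      have e : z - (⌊z.re - z₀.re⌋ : ℤ) = z₀ := by
        apply Complex.ext
        · simpa using heq.symm
        · simpa using him
      have := hGm ⌊z.re - z₀.re⌋ z
      rw [e] at this
      simp only [hφ, hz₀, sub_self] at this
      exact sub_eq_zero.1 this.symm
    · simp only [Set.mem_ofPred_eq, Complex.sub_re, Complex.intCast_re]
      have h1 := Int.lt_floor_add_one (z.re - z₀.re)
      linarith
  refine ⟨l, ?_, ?_⟩
  · intro z hz
    apply ContinuousAt.continuousWithinAt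
    rcases lt_trichotomy z.im z₀.im with h | h | h
    · refine (B1.continuousAt (Bo.mem_nhds h)).congr ?_
      filter_upwards [Bo.mem_nhds h] with w hw
      exact (lB w hw).symm
    · obtain ⟨m, hm⟩ := inC z h hz
      have hc : ContinuousAt (fun w : ℂ => LC (w - m)) z :=
        ContinuousAt.comp (f := fun w : ℂ => w - m) (C1.continuousAt (Co.mem_nhds hm)) (by fun_prop)
      refine hc.congr ?_
      have : (fun w : ℂ => w - m) ⁻¹' C ∈ 𝓝 z :=
        (Co.preimage (by fun_prop)).mem_nhds hm
      filter_upwards [this] with w hw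
      exact (lC m w hw).symm
    · refine (T1.continuousAt (To.mem_nhds h)).congr ?_
      filter_upwards [To.mem_nhds h] with w hw
      exact (lT w hw).symm
  · intro z hz
    rcases lt_trichotomy z.im z₀.im with h | h | h
    · rw [lB z h, B2 z h]
    · obtain ⟨m, hm⟩ := inC z h hz
      rw [lC m z hm, C2 _ hm, hGm]
    · rw [lT z h, T2 z h]

/-- the plane statement -/
theorem Std.two_fixed {G : ℂ ≃ₜ ℂ} (h : Rec G → Rec G.symm → {z | G z = z}.Countable → Std G)
    (hr1 : Rec G) (hr2 : Rec G.symm) :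
    ∃ z w, G z = z ∧ G w = w ∧ ∀ n : ℤ, w ≠ z + n := by
  by_contra hcon
  push Not at hcon
  by_cases hex : ∃ z₀, G z₀ = z₀
  · obtain ⟨z₀, hz₀⟩ := hex
    have hf : ∀ z, G z = z → ∃ n : ℤ, z = z₀ + n := fun z hz => hcon z₀ z hz₀ hz
    have st := h hr1 hr2 ((Set.countable_range (fun n : ℤ => z₀ + n)).mono (by
      intro z hz
      obtain ⟨n, hn⟩ := hf z hz
      exact ⟨n, hn.symm⟩))
    obtain ⟨l, h1, h2⟩ := st.exists_l hz₀ hf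
    exact st.false hr2 h1 h2
  · push Not at hex
    have st := h hr1 hr2 (by
      have : {z | G z = z} = ∅ := by
        ext z; simpa using hex z
      rw [this]; exact Set.countable_empty)
    obtain ⟨l, h1, h2⟩ := exists_log_convex (convex_univ (𝕜 := ℝ) (E := ℂ)) (φ := fun z => G z - z)
      (by have := G.continuous; fun_prop) (fun z _ => sub_ne_zero.2 (hex z))
    exact st.false hr2 (h1.mono (Set.subset_univ _)) (fun z _ => h2 z trivial)

end PB

namespace PB

/-- no local homeomorphism sends a boundary point to an interior point -/
theorem bdry_lemma {U : Set ℂ} {p c : ℂ} (hc : c ∈ U \ {p}) (hU : StarConvex ℝ c (U \ {p}))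
    {Φ Ψ : ℂ → ℂ} (hΦ : ContinuousOn Φ U) (hinj : ∀ z ∈ U, z ≠ p → Φ z ≠ Φ p) {r : ℝ} (hr : 0 < r)
    (hΨ : ContinuousOn Ψ (Metric.ball (Φ p) r)) (hΨU : ∀ w ∈ Metric.ball (Φ p) r, Ψ w ∈ U)
    (hΦΨ : ∀ w ∈ Metric.ball (Φ p) r, Φ (Ψ w) = w) : False := by
  obtain ⟨L, hL1, hL2⟩ := exists_log hc hU (φ := fun z => Φ z - Φ p)
    ((hΦ.mono Set.sdiff_subset).sub continuousOn_const)
    (fun z hz => sub_ne_zero.2 (hinj z hz.1 hz.2))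
  set w : ℝ → ℂ := fun t => Φ p + ((r / 2 : ℝ) : ℂ) * Complex.exp (t * Complex.I) with hw
  have hwc : Continuous w := by fun_prop
  have hwb : ∀ t, w t ∈ Metric.ball (Φ p) r := by
    intro t
    simp only [hw, Metric.mem_ball, dist_eq_norm, add_sub_cancel_left, norm_mul,
      Complex.norm_exp_ofReal_mul_I, Complex.norm_real, Real.norm_eq_abs, mul_one]
    rw [abs_of_pos (by linarith)]; linarith
  have hr2 : ((r / 2 : ℝ) : ℂ) ≠ 0 := by
    rw [Complex.ofReal_ne_zero]; linarith
  have hwne : ∀ t, w t ≠ Φ p := by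
    intro t h
    simp only [hw, add_eq_left, mul_eq_zero, Complex.exp_ne_zero, or_false] at h
    exact hr2 h
  have hΨm : ∀ t, Ψ (w t) ∈ U \ {p} := by
    intro t
    refine ⟨hΨU _ (hwb t), ?_⟩
    intro h
    apply hwne t
    rw [← hΦΨ _ (hwb t), Set.mem_singleton_iff.1 h]
  obtain ⟨n, hn⟩ := log_diff_const (s := (Set.univ : Set ℝ)) isPreconnected_univ
    (L₁ := fun t => L (Ψ (w t))) (L₂ := fun t => Complex.log ((r / 2 : ℝ) : ℂ) + t * Complex.I)
    (hL1.comp (hΨ.comp hwc.continuousOn (fun t _ => hwb t)) (fun t _ => hΨm t)) (by fun_prop)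
    (by
      intro t _
      rw [hL2 _ (hΨm t), hΦΨ _ (hwb t), Complex.exp_add, Complex.exp_log hr2]
      simp [hw])
  have e1 := hn 0 trivial
  have e2 := hn (2 * Real.pi) trivial
  have e3 : w (2 * Real.pi) = w 0 := by
    simp [hw]
  simp only [e3] at e2
  rw [e1] at e2
  have := congrArg Complex.im e2
  simp at this

/-- projection of the plane to the annulus -/
noncomputable def toAnn (z : ℂ) : AnnC :=
  ((z.re : Circle1), Set.projIcc (0 : ℝ) 1 zero_le_one z.im)

theorem toAnn_continuous : Continuous toAnn := by
  unfold toAnn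
  refine Continuous.prodMk ?_ ?_
  · exact (AddCircle.continuous_mk' 1).comp Complex.continuous_re
  · exact continuous_projIcc.comp Complex.continuous_im

/-- chart of the annulus -/
noncomputable def ch (a : ℝ) (u : AnnC) : ℂ :=
  ((AddCircle.equivIco 1 a u.1 : ℝ) : ℂ) + ((u.2 : ℝ) : ℂ) * Complex.I

theorem toAnn_ch (a : ℝ) (u : AnnC) : toAnn (ch a u) = u := by
  unfold toAnn ch
  refine Prod.ext ?_ ?_
  · simpa using AddCircle.coe_equivIco (p := (1 : ℝ)) (a := a) (x := u.1)
  · simp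

theorem ch_toAnn {a : ℝ} {w : ℂ} (h1 : a ≤ w.re) (h2 : w.re < a + 1) (h3 : 0 ≤ w.im)
    (h4 : w.im ≤ 1) : ch a (toAnn w) = w := by
  unfold toAnn ch
  apply Complex.ext
  · simp [AddCircle.equivIco_coe_of_mem (p := (1 : ℝ)) (a := a) ⟨h1, h2⟩]
  · simp [Set.projIcc_of_mem zero_le_one ⟨h3, h4⟩]

theorem ch_continuous (a : ℝ) : ContinuousOn (ch a) {u | u.1 ≠ (a : Circle1)} := by
  intro u hu
  apply ContinuousAt.continuousWithinAt
  have h1 : ContinuousAt (fun u : AnnC => (AddCircle.equivIco 1 a u.1 : ℝ)) u :=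
    continuousAt_subtype_val.comp
      ((AddCircle.continuousAt_equivIco 1 a hu).comp continuousAt_fst)
  unfold ch
  refine ContinuousAt.add ?_ ?_
  · exact Complex.continuous_ofReal.continuousAt.comp h1
  · fun_prop

theorem coe_eq_iff {x y : ℝ} : (x : Circle1) = y ↔ ∃ n : ℤ, x = y + n := by
  rw [← sub_eq_zero, ← AddCircle.coe_sub, AddCircle.coe_eq_zero_iff]
  constructor
  · rintro ⟨n, hn⟩; refine ⟨n, ?_⟩; simp at hn; linarith
  · rintro ⟨n, hn⟩; refine ⟨n, ?_⟩; simp; linarith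

theorem toAnn_inj {z w : ℂ} (h : toAnn z = toAnn w) (h1 : |z.re - w.re| < 1)
    (hz : 0 ≤ z.im ∧ z.im ≤ 1) (hw : 0 ≤ w.im ∧ w.im ≤ 1) : z = w := by
  have e1 := congrArg Prod.fst h
  have e2 := congrArg (fun u => (u.2 : ℝ)) h
  simp only [toAnn] at e1 e2
  rw [Set.projIcc_of_mem zero_le_one hz, Set.projIcc_of_mem zero_le_one hw] at e2
  obtain ⟨n, hn⟩ := coe_eq_iff.1 e1
  rw [hn, add_sub_cancel_left] at h1
  have h2 : |n| < 1 := by exact_mod_cast h1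
  rw [Int.abs_lt_one_iff] at h2
  rw [h2] at hn
  exact Complex.ext (by simpa using hn) e2

theorem bdry_inv (g : AnnC ≃ₜ AnnC) (p : AnnC) (hp : (p.2 : ℝ) = 0 ∨ (p.2 : ℝ) = 1) :
    ((g p).2 : ℝ) = 0 ∨ ((g p).2 : ℝ) = 1 := by
  by_contra hcon
  push Not at hcon
  obtain ⟨hc0, hc1⟩ := hcon
  have hq0 : 0 < ((g p).2 : ℝ) := lt_of_le_of_ne (g p).2.2.1 (Ne.symm hc0)
  have hq1 : ((g p).2 : ℝ) < 1 := lt_of_le_of_ne (g p).2.2.2 hc1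
  -- lifts
  have hlift : ∀ u : AnnC, ∃ x : ℝ, (x : Circle1) = u.1 := fun u =>
    QuotientAddGroup.mk_surjective u.1
  obtain ⟨xp, hxp⟩ := hlift p
  obtain ⟨xq, hxq⟩ := hlift (g p)
  set zp : ℂ := (xp : ℂ) + ((p.2 : ℝ) : ℂ) * Complex.I with hzp
  set zq : ℂ := (xq : ℂ) + (((g p).2 : ℝ) : ℂ) * Complex.I with hzq
  have zpre : zp.re = xp := by simp [hzp]
  have zpim : zp.im = p.2 := by simp [hzp]
  have zqre : zq.re = xq := by simp [hzq]
  have zqim : zq.im = (g p).2 := by simp [hzq]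
  have Ap : toAnn zp = p := by
    unfold toAnn
    rw [zpre, zpim, Set.projIcc_val]
    exact Prod.ext hxp rfl
  have Aq : toAnn zq = g p := by
    unfold toAnn
    rw [zqre, zqim, Set.projIcc_val]
    exact Prod.ext hxq rfl
  set a := xp - 1 / 2 with ha
  set b := xq - 1 / 2 with hb
  have chp : ch a p = zp := by
    rw [← Ap, ch_toAnn] <;> [rw [zpre]; rw [zpre]; rw [zpim]; rw [zpim]]
    · linarith
    · linarith
    · exact p.2.2.1
    · exact p.2.2.2
  have chq : ch b (g p) = zq := by
    rw [← Aq, ch_toAnn] <;> [rw [zqre]; rw [zqre]; rw [zqim]; rw [zqim]] <;> linarith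
  have hhalf : ∀ x : ℝ, (x : Circle1) ≠ ((x - 1 / 2 : ℝ) : Circle1) := by
    intro x h
    obtain ⟨n, hn⟩ := coe_eq_iff.1 h
    have h1 : (n : ℝ) * 2 = 1 := by linarith
    have h2 : n * 2 = 1 := by exact_mod_cast h1
    omega
  have hpa : p.1 ≠ (a : Circle1) := by rw [← hxp]; exact hhalf xp
  have hqb : (g p).1 ≠ (b : Circle1) := by rw [← hxq]; exact hhalf xq
  -- domain
  have hO : IsOpen {z : ℂ | (g (toAnn z)).1 ≠ (b : Circle1)} :=
    isOpen_ne.preimage (continuous_fst.comp (g.continuous.comp toAnn_continuous))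
  obtain ⟨δ', hδ', hδO'⟩ := Metric.isOpen_iff.1 hO zp (by
    show (g (toAnn zp)).1 ≠ (b : Circle1)
    rw [Ap]; exact hqb)
  set δ := min δ' 1 with hδdef
  have hδ : 0 < δ := lt_min hδ' one_pos
  have hδ1 : δ ≤ 1 := min_le_right _ _
  have hδO := (Metric.ball_subset_ball (min_le_left δ' 1)).trans hδO'
  set U : Set ℂ := Metric.ball zp δ ∩ ({z | 0 ≤ z.im} ∩ {z | z.im ≤ 1}) with hU
  have Uc : Convex ℝ U :=
    (convex_ball _ _).inter ((convex_halfSpace_im_ge _).inter (convex_halfSpace_im_le _))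
  obtain ⟨c, hcU, hcim⟩ : ∃ c ∈ U, (zp.im = 0 ∧ 0 < c.im) ∨ (zp.im = 1 ∧ c.im < 1) := by
    rcases hp with hp | hp
    · refine ⟨zp + ((δ / 2 : ℝ) : ℂ) * Complex.I, ⟨?_, ?_, ?_⟩, Or.inl ⟨by rw [zpim, hp], ?_⟩⟩
      · simp [dist_eq_norm, abs_of_pos hδ]; linarith
      · simp [zpim, hp]; linarith
      · simp [zpim, hp]; linarith
      · simp [zpim, hp]; linarith
    · refine ⟨zp - ((δ / 2 : ℝ) : ℂ) * Complex.I, ⟨?_, ?_, ?_⟩, Or.inr ⟨by rw [zpim, hp], ?_⟩⟩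
      · simp [dist_eq_norm, abs_of_pos hδ]; linarith
      · simp [zpim, hp]; linarith
      · simp [zpim, hp]; linarith
      · simp [zpim, hp]; linarith
  have hcU' : c ∈ U \ {zp} := by
    refine ⟨hcU, ?_⟩
    intro h
    rw [Set.mem_singleton_iff] at h
    rw [h] at hcim
    rcases hcim with ⟨h1, h2⟩ | ⟨h1, h2⟩ <;> linarith
  have hstar : StarConvex ℝ c (U \ {zp}) := by
    intro z hz s t hs ht hst
    refine ⟨Uc.starConvex hcU hz.1 hs ht hst, ?_⟩
    intro h
    rw [Set.mem_singleton_iff] at h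
    have him := congrArg Complex.im h
    simp at him
    have hz0 : 0 ≤ z.im := hz.1.2.1
    have hz1 : z.im ≤ 1 := hz.1.2.2
    have hs0 : s = 0 := by
      rcases hcim with ⟨h1, h2⟩ | ⟨h1, h2⟩
      · rw [h1] at him
        by_contra hne
        have : 0 < s := lt_of_le_of_ne hs (Ne.symm hne)
        nlinarith [mul_pos this h2, mul_nonneg ht hz0]
      · rw [h1] at him
        by_contra hne
        have : 0 < s := lt_of_le_of_ne hs (Ne.symm hne)
        nlinarith [mul_pos this (sub_pos.2 h2), mul_nonneg ht (sub_nonneg.2 hz1)]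
    have ht1 : t = 1 := by linarith
    rw [hs0, ht1] at h
    simp at h
    exact hz.2 h
  have hΦp : ch b (g (toAnn zp)) = zq := by rw [Ap, chq]
  -- inverse
  have hΨo : IsOpen {w : ℂ | (g.symm (toAnn w)).1 ≠ (a : Circle1)} :=
    isOpen_ne.preimage (continuous_fst.comp (g.symm.continuous.comp toAnn_continuous))
  have hΨc : ContinuousOn (fun w => ch a (g.symm (toAnn w)))
      {w : ℂ | (g.symm (toAnn w)).1 ≠ (a : Circle1)} :=
    (ch_continuous a).comp (g.symm.continuous.comp toAnn_continuous).continuousOn (fun w hw => hw)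
  have hzqm : zq ∈ {w : ℂ | (g.symm (toAnn w)).1 ≠ (a : Circle1)} := by
    show (g.symm (toAnn zq)).1 ≠ (a : Circle1)
    rw [Aq]; simpa using hpa
  have hΨq : ch a (g.symm (toAnn zq)) = zp := by rw [Aq]; simpa using chp
  have ev : ∀ᶠ w in 𝓝 zq, (g.symm (toAnn w)).1 ≠ (a : Circle1) ∧
      ch a (g.symm (toAnn w)) ∈ Metric.ball zp δ ∧ 0 < w.im ∧ w.im < 1 ∧ b < w.re ∧ w.re < b + 1 := by
    have hcat := hΨc.continuousAt (hΨo.mem_nhds hzqm)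
    have t1 : ∀ᶠ w in 𝓝 zq, ch a (g.symm (toAnn w)) ∈ Metric.ball zp δ := by
      have : Tendsto (fun w => ch a (g.symm (toAnn w))) (𝓝 zq) (𝓝 zp) := by
        have h := hcat.tendsto
        simp only [hΨq] at h
        exact h
      exact this (Metric.ball_mem_nhds zp hδ)
    filter_upwards [hΨo.mem_nhds hzqm, t1,
      (isOpen_lt continuous_const Complex.continuous_im).mem_nhds (show 0 < zq.im by rw [zqim]; exact hq0),
      (isOpen_lt Complex.continuous_im continuous_const).mem_nhds (show zq.im < 1 by rw [zqim]; exact hq1),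
      (isOpen_lt continuous_const Complex.continuous_re).mem_nhds (show b < zq.re by rw [zqre]; linarith),
      (isOpen_lt Complex.continuous_re continuous_const).mem_nhds
        (show zq.re < b + 1 by rw [zqre]; linarith)] with w h1 h2 h3 h4 h5 h6
    exact ⟨h1, h2, h3, h4, h5, h6⟩
  obtain ⟨r, hr, hrw⟩ := Metric.eventually_nhds_iff_ball.1 ev
  refine bdry_lemma (U := U) (p := zp) (c := c) hcU' hstar (Φ := fun z => ch b (g (toAnn z)))
    (Ψ := fun w => ch a (g.symm (toAnn w))) ?_ ?_ hr ?_ ?_ ?_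
  · exact (ch_continuous b).comp (g.continuous.comp toAnn_continuous).continuousOn
      (fun z hz => hδO hz.1)
  · intro z hz hne heq
    apply hne
    have h1 := congrArg toAnn heq
    simp only [toAnn_ch] at h1
    have h2 := g.injective h1
    refine toAnn_inj h2 ?_ hz.2 ?_
    · have h3 := Complex.abs_re_le_norm (z - zp)
      have h4 := hz.1
      rw [Metric.mem_ball, dist_eq_norm] at h4
      rw [Complex.sub_re] at h3
      linarith
    · rw [zpim]; exact p.2.2
  · simp only [hΦp]
    exact hΨc.mono fun w hw => (hrw w hw).1
  · simp only [hΦp]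
    intro w hw
    refine ⟨(hrw w hw).2.1, ?_, ?_⟩
    · simpa [ch] using (g.symm (toAnn w)).2.2.1
    · simpa [ch] using (g.symm (toAnn w)).2.2.2
  · simp only [hΦp]
    intro w hw
    obtain ⟨-, -, h3, h4, h5, h6⟩ := hrw w hw
    rw [toAnn_ch, Homeomorph.apply_symm_apply, ch_toAnn h5.le h6 h3.le h4.le]

theorem bdry_iff {f : AnnC ≃ₜ AnnC} (hiso : IsotopicToIdC f) :
    (∀ p, ((f p).2 : ℝ) = 0 ↔ (p.2 : ℝ) = 0) ∧ (∀ p, ((f p).2 : ℝ) = 1 ↔ (p.2 : ℝ) = 1) := by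
  obtain ⟨H, Hc, H0, H1, Hh⟩ := hiso
  have hb : ∀ t p, ((p.2 : ℝ) = 0 ∨ (p.2 : ℝ) = 1) →
      ((H (t, p)).2 : ℝ) = 0 ∨ ((H (t, p)).2 : ℝ) = 1 := by
    intro t p hp
    obtain ⟨g, hg⟩ := Hh t
    rw [hg]; exact bdry_inv g p hp
  have hno : ∀ p, ((p.2 : ℝ) = 0 ∨ (p.2 : ℝ) = 1) → ∀ t s,
      ¬ (((H (t, p)).2 : ℝ) = 0 ∧ ((H (s, p)).2 : ℝ) = 1) := by
    rintro p hp t s ⟨h1, h2⟩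
    have hc : Continuous (fun t => ((H (t, p)).2 : ℝ)) := by fun_prop
    obtain ⟨u, hu⟩ := mem_range_of_exists_le_of_exists_ge hc (c := 1 / 2)
      ⟨t, by rw [h1]; norm_num⟩ ⟨s, by rw [h2]; norm_num⟩
    simp only at hu
    rcases hb u p hp with h | h <;> rw [h] at hu <;> norm_num at hu
  have f0 : ∀ p, (p.2 : ℝ) = 0 → ((f p).2 : ℝ) = 0 := by
    intro p hp
    rcases hb ⟨1, by norm_num⟩ p (Or.inl hp) with h | h
    · rwa [H1] at h
    · exact absurd ⟨by rw [H0]; exact hp, h⟩ (hno p (Or.inl hp) ⟨0, by norm_num⟩ ⟨1, by norm_num⟩)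
  have f1 : ∀ p, (p.2 : ℝ) = 1 → ((f p).2 : ℝ) = 1 := by
    intro p hp
    rcases hb ⟨1, by norm_num⟩ p (Or.inr hp) with h | h
    · exact absurd ⟨h, by rw [H0]; exact hp⟩ (hno p (Or.inr hp) ⟨1, by norm_num⟩ ⟨0, by norm_num⟩)
    · rwa [H1] at h
  refine ⟨fun p => ⟨fun h => ?_, f0 p⟩, fun p => ⟨fun h => ?_, f1 p⟩⟩
  · rcases bdry_inv f.symm (f p) (Or.inl h) with h1 | h1
    · simpa using h1
    · have := f1 p (by simpa using h1)
      rw [this] at h; norm_num at h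
  · rcases bdry_inv f.symm (f p) (Or.inr h) with h1 | h1
    · have := f0 p (by simpa using h1)
      rw [this] at h; norm_num at h
    · simpa using h1

end PB

namespace PB

noncomputable def pI (y : ℝ) : ↥(Set.Icc (0 : ℝ) 1) := Set.projIcc (0 : ℝ) 1 zero_le_one y

theorem pI_bot {y : ℝ} (h : y ≤ 0) : (pI y : ℝ) = 0 := by
  simp [pI, Set.projIcc_of_le_left zero_le_one h]
theorem pI_top {y : ℝ} (h : 1 ≤ y) : (pI y : ℝ) = 1 := by
  simp [pI, Set.projIcc_of_right_le zero_le_one h]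
theorem pI_mid {y : ℝ} (h : 0 ≤ y) (h1 : y ≤ 1) : (pI y : ℝ) = y := by
  simp [pI, Set.projIcc_of_mem zero_le_one ⟨h, h1⟩]
theorem pI_coe (y : ↥(Set.Icc (0 : ℝ) 1)) : pI y = y := Set.projIcc_val _ _
theorem pI_continuous : Continuous pI := by
  unfold pI; exact continuous_projIcc

/-- extension of a map of the strip to the plane -/
noncomputable def extFun (F : StripC → StripC) (z : ℂ) : ℂ :=
  ((F (z.re, pI z.im)).1 : ℂ) +
    ((((F (z.re, pI z.im)).2 : ℝ) + (z.im - pI z.im) : ℝ) : ℂ) * Complex.I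

theorem extFun_re (F : StripC → StripC) (z : ℂ) : (extFun F z).re = (F (z.re, pI z.im)).1 := by
  simp [extFun]
theorem extFun_im (F : StripC → StripC) (z : ℂ) :
    (extFun F z).im = (F (z.re, pI z.im)).2 + (z.im - pI z.im) := by
  simp [extFun]

theorem extFun_continuous {F : StripC → StripC} (hF : Continuous F) : Continuous (extFun F) := by
  have h1 : Continuous (fun z : ℂ => F (z.re, pI z.im)) :=
    hF.comp (Complex.continuous_re.prodMk (pI_continuous.comp Complex.continuous_im))
  have h2 : Continuous (fun z : ℂ => (pI z.im : ℝ)) :=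
    continuous_subtype_val.comp (pI_continuous.comp Complex.continuous_im)
  have h3 : Continuous (fun z : ℂ => (F (z.re, pI z.im)).1) := continuous_fst.comp h1
  have h4 : Continuous (fun z : ℂ => ((F (z.re, pI z.im)).2 : ℝ)) :=
    continuous_subtype_val.comp (continuous_snd.comp h1)
  exact (Complex.continuous_ofReal.comp h3).add
    ((Complex.continuous_ofReal.comp (h4.add (Complex.continuous_im.sub h2))).mul
      continuous_const)

/-- preservation of the two boundary lines -/
structure Bd (F : StripC → StripC) : Prop where
  b0 : ∀ p, ((F p).2 : ℝ) = 0 ↔ (p.2 : ℝ) = 0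
  b1 : ∀ p, ((F p).2 : ℝ) = 1 ↔ (p.2 : ℝ) = 1

theorem Bd.symm {F : StripC ≃ₜ StripC} (h : Bd F) : Bd F.symm :=
  ⟨fun p => by rw [← h.b0]; simp, fun p => by rw [← h.b1]; simp⟩

theorem extFun_bot {F : StripC → StripC} (h : Bd F) {z : ℂ} (hz : z.im ≤ 0) :
    (extFun F z).im = z.im := by
  rw [extFun_im, pI_bot hz, (h.b0 _).2 (pI_bot hz)]; ring
theorem extFun_top {F : StripC → StripC} (h : Bd F) {z : ℂ} (hz : 1 ≤ z.im) :
    (extFun F z).im = z.im := by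
  rw [extFun_im, pI_top hz, (h.b1 _).2 (pI_top hz)]; ring
theorem extFun_mid {F : StripC → StripC} {z : ℂ} (hz : 0 ≤ z.im) (hz1 : z.im ≤ 1) :
    (extFun F z).im = (F (z.re, pI z.im)).2 := by
  rw [extFun_im, pI_mid hz hz1]; ring

theorem pI_ext {F : StripC → StripC} (h : Bd F) (z : ℂ) :
    pI (extFun F z).im = (F (z.re, pI z.im)).2 := by
  rcases le_total z.im 0 with h0 | h0
  · apply Subtype.ext
    rw [extFun_bot h h0, pI_bot h0, (h.b0 _).2 (pI_bot h0)]
  · rcases le_total z.im 1 with h1 | h1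
    · rw [extFun_mid h0 h1, pI_coe]
    · apply Subtype.ext
      rw [extFun_top h h1, pI_top h1, (h.b1 _).2 (pI_top h1)]

theorem ext_inv {F : StripC ≃ₜ StripC} (h : Bd F) (z : ℂ) : extFun F.symm (extFun F z) = z := by
  have e : ((extFun F z).re, pI (extFun F z).im) = F (z.re, pI z.im) := by
    rw [pI_ext h, extFun_re]
  apply Complex.ext
  · rw [extFun_re, e]; simp
  · rw [extFun_im, e, pI_ext h, extFun_im]; simp

noncomputable def ext (F : StripC ≃ₜ StripC) (h : Bd F) : ℂ ≃ₜ ℂ where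
  toFun := extFun F
  invFun := extFun F.symm
  left_inv := ext_inv h
  right_inv z := by
    have := ext_inv h.symm z
    simpa using this
  continuous_toFun := extFun_continuous F.continuous
  continuous_invFun := extFun_continuous F.symm.continuous

theorem ext_apply (F : StripC ≃ₜ StripC) (h : Bd F) (z : ℂ) : ext F h z = extFun F z := rfl
theorem ext_symm (F : StripC ≃ₜ StripC) (h : Bd F) : (ext F h).symm = ext F.symm h.symm := rfl

/-- inclusion of the strip -/
noncomputable def inc (p : StripC) : ℂ := (p.1 : ℂ) + ((p.2 : ℝ) : ℂ) * Complex.I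

theorem inc_re (p : StripC) : (inc p).re = p.1 := by simp [inc]
theorem inc_im (p : StripC) : (inc p).im = p.2 := by simp [inc]
theorem inc_continuous : Continuous inc := by unfold inc; fun_prop
theorem ext_inc (F : StripC → StripC) (p : StripC) : extFun F (inc p) = inc (F p) := by
  have e : ((inc p).re, pI (inc p).im) = p := by rw [inc_re, inc_im, pI_coe]
  apply Complex.ext
  · rw [extFun_re, e, inc_re]
  · rw [extFun_im, e, inc_im, inc_im, pI_coe]; ring
theorem exists_inc {z : ℂ} (h0 : 0 ≤ z.im) (h1 : z.im ≤ 1) : ∃ p, inc p = z :=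
  ⟨(z.re, ⟨z.im, h0, h1⟩), by apply Complex.ext <;> simp [inc]⟩
theorem inc_injective : Function.Injective inc := by
  intro p q h
  have h1 := congrArg Complex.re h
  have h2 := congrArg Complex.im h
  rw [inc_re, inc_re] at h1
  rw [inc_im, inc_im] at h2
  exact Prod.ext h1 (Subtype.ext h2)
theorem inc_deck (p : StripC) : inc (deckC p) = inc p + 1 := by
  simp [inc, deckC]; ring

theorem projC_eq {p q : StripC} (h : projC p = projC q) : ∃ n : ℤ, inc p = inc q + n := by
  have h1 := congrArg Prod.fst h
  have h2 := congrArg Prod.snd h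
  simp only [projC] at h1 h2
  obtain ⟨n, hn⟩ := coe_eq_iff.1 h1
  refine ⟨n, ?_⟩
  apply Complex.ext
  · simp [inc_re, hn]
  · simp [inc_im, h2]

theorem projC_open : IsOpenMap projC := by
  have h : IsOpenMap (Prod.map (fun x : ℝ => (x : Circle1)) (id : ↥(Set.Icc (0 : ℝ) 1) → _)) :=
    (QuotientAddGroup.isOpenMap_coe).prodMap IsOpenMap.id
  exact h

theorem projC_continuous : Continuous projC :=
  ((AddCircle.continuous_mk' (1 : ℝ)).comp continuous_fst).prodMk continuous_snd

theorem ext_T {F : StripC → StripC} (hcomm : ∀ p, F (deckC p) = deckC (F p)) (z : ℂ) :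
    extFun F (z + 1) = extFun F z + 1 := by
  have e : F ((z + 1).re, pI (z + 1).im) = deckC (F (z.re, pI z.im)) := by
    rw [← hcomm]; simp [deckC]
  apply Complex.ext
  · rw [extFun_re, e, Complex.add_re, extFun_re]; simp [deckC]
  · have h2 : (extFun F z + 1).im = (extFun F z).im := by simp
    rw [extFun_im, e, h2, extFun_im]; simp [deckC]

theorem ext_rec {f : AnnC ≃ₜ AnnC} {F : StripC ≃ₜ StripC} (h : Bd F) {μ : Measure AnnC}
    (hfin : μ Set.univ < ⊤) (hpos : ∀ U : Set AnnC, IsOpen U → U.Nonempty → 0 < μ U)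
    (hmp : MeasurePreserving f μ μ) (hlift : ∀ p, projC (F p) = f (projC p))
    (hcomm : ∀ p, F (deckC p) = deckC (F p)) : Rec (ext F h) := by
  intro R hR hper hfwd z hz h0 h1
  set V : Set StripC := inc ⁻¹' R with hV
  have hVo : IsOpen V := hR.preimage inc_continuous
  set v : Set AnnC := projC '' V with hv
  have hvo : IsOpen v := projC_open _ hVo
  have hfv : f '' v ⊆ v := by
    rintro _ ⟨_, ⟨p, hp, rfl⟩, rfl⟩
    refine ⟨F p, ?_, hlift p⟩
    have := hfwd (inc p) hp (by rw [inc_im]; exact p.2.2.1) (by rw [inc_im]; exact p.2.2.2)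
    rw [ext_apply, ext_inc] at this
    exact this
  have hfvo : IsOpen (f '' v) := f.isOpenMap _ hvo
  have hμ : μ (f '' v) = μ v := by
    have := hmp.measure_preimage hfvo.measurableSet.nullMeasurableSet
    rw [Set.preimage_image_eq _ f.injective] at this
    exact this.symm
  have hsub : v ⊆ closure (f '' v) := by
    by_contra hcon
    have hne : (v \ closure (f '' v)).Nonempty := Set.sdiff_nonempty.2 hcon
    have ho : IsOpen (v \ closure (f '' v)) := hvo.sdiff isClosed_closure
    have hp := hpos _ ho hne
    have hle : μ (v \ closure (f '' v)) ≤ μ (v \ f '' v) :=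
      measure_mono (Set.sdiff_subset_sdiff_right subset_closure)
    rw [measure_sdiff hfv hfvo.measurableSet.nullMeasurableSet
      ((measure_mono (Set.subset_univ _)).trans_lt hfin).ne, hμ, tsub_self] at hle
    exact absurd (hp.trans_le hle) (lt_irrefl _)
  obtain ⟨p, rfl⟩ := exists_inc h0.le h1.le
  rw [mem_closure_iff]
  intro N hN hpN
  have hNo : IsOpen (inc ⁻¹' N) := hN.preimage inc_continuous
  have hpv : projC p ∈ closure (f '' v) := hsub ⟨p, hz, rfl⟩
  obtain ⟨u, ⟨n, hn, hnu⟩, ⟨_, ⟨q, hq, rfl⟩, hqu⟩⟩ :=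
    mem_closure_iff.1 hpv _ (projC_open _ hNo) ⟨p, hpN, rfl⟩
  have e : projC (F q) = projC n := by rw [hlift, hqu, hnu]
  obtain ⟨k, hk⟩ := projC_eq e
  refine ⟨inc n, hn, inc q - k, ?_, ?_⟩
  · exact (per_int (L := fun _ => 0) hper (fun _ _ => rfl) k (inc q) hq).2
  · have e2 := (per_int (L := fun z => extFun F z - z) (s := Set.univ) (by simp)
      (fun z _ => by simp [ext_T hcomm]) k (inc q) trivial).1
    simp only [ext_inc] at e2
    rw [ext_apply]
    linear_combination e2 + hk

end PB

/-- Poincaré–Birkhoff theorem: an area-preserving homeomorphism of the closed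
annulus isotopic to the identity, with a lift rotating the two boundary lines
in opposite directions, has at least two distinct interior fixed points, each
admitting a lift fixed by `F`. -/
theorem poincare_birkhoff (f : AnnC ≃ₜ AnnC)
    (hiso : IsotopicToIdC f) (harea : PreservesFiniteAreaC f)
    (F : StripC ≃ₜ StripC) (hlift : ∀ p, projC (F p) = f (projC p))
    (hcomm : ∀ p, F (deckC p) = deckC (F p))
    (hbd0 : ∀ x : ℝ, (F (x, ⟨0, by norm_num⟩)).1 < x)
    (hbd1 : ∀ x : ℝ, x < (F (x, ⟨1, by norm_num⟩)).1) :
    ∃ z₁ z₂ : AnnC, z₁ ≠ z₂ ∧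
      f z₁ = z₁ ∧ f z₂ = z₂ ∧
      (0 : ℝ) < z₁.2 ∧ (z₁.2 : ℝ) < 1 ∧ (0 : ℝ) < z₂.2 ∧ (z₂.2 : ℝ) < 1 ∧
      (∃ zt₁ : StripC, projC zt₁ = z₁ ∧ F zt₁ = zt₁) ∧
      (∃ zt₂ : StripC, projC zt₂ = z₂ ∧ F zt₂ = zt₂) := by
  obtain ⟨μ, hfin, _, hpos, hmp⟩ := harea
  obtain ⟨k0, k1⟩ := PB.bdry_iff hiso
  have e2 : ∀ p, (F p).2 = (f (projC p)).2 := fun p => by rw [← hlift]; rfl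
  have h : PB.Bd F := ⟨fun p => by rw [e2]; exact k0 (projC p),
    fun p => by rw [e2]; exact k1 (projC p)⟩
  have hr1 : PB.Rec (PB.ext F h) := PB.ext_rec h hfin hpos hmp hlift hcomm
  have hmp' : MeasurePreserving f.symm μ μ := MeasurePreserving.symm f.toMeasurableEquiv hmp
  have hr2 : PB.Rec (PB.ext F h).symm := by
    rw [PB.ext_symm]
    refine PB.ext_rec h.symm hfin hpos hmp' (fun p => ?_) (fun p => ?_)
    · apply f.injective
      rw [← hlift]; simp
    · apply F.injective
      rw [hcomm]; simp
  have hbot : ∀ z : ℂ, z.im ≤ 0 → (PB.ext F h z).im = z.im ∧ (PB.ext F h z).re < z.re := by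
    intro z hz
    refine ⟨PB.extFun_bot h hz, ?_⟩
    have e : PB.pI z.im = ⟨0, by norm_num⟩ := Subtype.ext (PB.pI_bot hz)
    rw [PB.ext_apply, PB.extFun_re, e]
    exact hbd0 _
  have htop : ∀ z : ℂ, 1 ≤ z.im → (PB.ext F h z).im = z.im ∧ z.re < (PB.ext F h z).re := by
    intro z hz
    refine ⟨PB.extFun_top h hz, ?_⟩
    have e : PB.pI z.im = ⟨1, by norm_num⟩ := Subtype.ext (PB.pI_top hz)
    rw [PB.ext_apply, PB.extFun_re, e]
    exact hbd1 _
  have hb : ∀ z : ℂ, (PB.ext F h z).im ≤ 0 → z.im ≤ 0 := by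
    intro z hz
    by_contra hc
    push Not at hc
    rcases le_total z.im 1 with h1 | h1
    · rw [PB.ext_apply, PB.extFun_mid hc.le h1] at hz
      have e := (h.b0 _).1 (le_antisymm hz (F (z.re, PB.pI z.im)).2.2.1)
      simp only [PB.pI_mid hc.le h1] at e
      exact hc.ne e.symm
    · rw [(htop z h1).1] at hz
      linarith
  have ht : ∀ z : ℂ, 1 ≤ (PB.ext F h z).im → 1 ≤ z.im := by
    intro z hz
    by_contra hc
    push Not at hc
    rcases le_total 0 z.im with h1 | h1
    · rw [PB.ext_apply, PB.extFun_mid h1 hc.le] at hz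
      have e := (h.b1 _).1 (le_antisymm (F (z.re, PB.pI z.im)).2.2.2 hz)
      simp only [PB.pI_mid h1 hc.le] at e
      exact hc.ne e
    · rw [(hbot z h1).1] at hz
      linarith
  obtain ⟨z, w, hz, hw, hzw⟩ := PB.Std.two_fixed (G := PB.ext F h)
    (fun a _ c => ⟨PB.ext_T hcomm, hbot, htop, hb, ht, a, c⟩) hr1 hr2
  have key : ∀ z : ℂ, PB.ext F h z = z →
      ∃ p : StripC, PB.inc p = z ∧ F p = p ∧ (0 : ℝ) < p.2 ∧ (p.2 : ℝ) < 1 := by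
    intro z hz
    have z0 : 0 < z.im := by
      by_contra hc
      have := (hbot z (not_lt.1 hc)).2
      rw [hz] at this
      exact lt_irrefl _ this
    have z1 : z.im < 1 := by
      by_contra hc
      have := (htop z (not_lt.1 hc)).2
      rw [hz] at this
      exact lt_irrefl _ this
    obtain ⟨p, rfl⟩ := PB.exists_inc z0.le z1.le
    rw [PB.ext_apply, PB.ext_inc] at hz
    rw [PB.inc_im] at z0 z1
    exact ⟨p, rfl, PB.inc_injective hz, z0, z1⟩
  obtain ⟨p, rfl, hp, hp0, hp1⟩ := key z hz
  obtain ⟨q, rfl, hq, hq0, hq1⟩ := key w hw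
  refine ⟨projC p, projC q, ?_, ?_, ?_, hp0, hp1, hq0, hq1, ⟨p, rfl, hp⟩, ⟨q, rfl, hq⟩⟩
  · intro e
    obtain ⟨n, hn⟩ := PB.projC_eq e.symm
    exact hzw n hn
  · rw [← hlift, hp]
  · rw [← hlift, hq]
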